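/- arXiv:2501.02249 — 2 statements merged into one kernel-verified Lean document; each statement's English description precedes it below -/
import Mathlib

section
/- If every maximal subgroup of a finite group G is either nilpotent or has index equal to a prime or the square of a prime, then G is solvable. -/
namespace PrimeSq

open Subgroup MulAction
open scoped commutatorElement

theorem nilp_comm {G : Type*} [Group G] {M P : Subgroup G} (hM : Group.IsNilpotent M)
    (hPM : P ≤ M) (h : P ≤ ⁅P, M⁆) : P = ⊥ := by
  obtain ⟨n, hn⟩ := (isNilpotent_iff_lowerCentralSeries M).1 hM
  have key : ∀ k, P ≤ M.lowerCentralSeries k := by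
    intro k
    induction k with
    | zero => simpa using hPM
    | succ k ih =>
      rw [Subgroup.lowerCentralSeries_succ]
      exact h.trans (commutator_mono ih le_rfl)
  have := key n
  rw [hn] at this
  exact le_bot_iff.1 this

theorem relIndex_normal_sup {G : Type*} [Group G] [Finite G] (H N : Subgroup G) [N.Normal] :
    H.relIndex N = H.relIndex (H ⊔ N) := by
  have h1 := relIndex_mul_relIndex (H ⊓ N) N (H ⊔ N) inf_le_right le_sup_right
  have h2 := relIndex_mul_relIndex (H ⊓ N) H (H ⊔ N) inf_le_left le_sup_left
  rw [inf_relIndex_right, relIndex_sup_right] at h1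
  rw [inf_relIndex_left, ← h1, mul_comm] at h2
  exact (Nat.eq_of_mul_eq_mul_right (Nat.pos_of_ne_zero index_ne_zero_of_finite) h2).symm

theorem transfer_pow {N : Type*} [Group N] [Finite N] (H : Subgroup N) {A : Type*} [CommGroup A]
    (φ : H →* A)
    (hf : ∀ (x : H) (g : N) (hg : g⁻¹ * x * g ∈ H), φ ⟨g⁻¹ * x * g, hg⟩ = φ x) (x : H) :
    MonoidHom.transfer φ (x : N) = φ x ^ H.index := by
  classical
  let := H.fintypeQuotientOfFiniteIndex
  rw [MonoidHom.transfer_eq_prod_quotient_orbitRel_zpowers_quot, index_eq_sum_minimalPeriod H (x : N),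
    ← Finset.prod_pow_eq_pow_sum]
  refine Finset.prod_congr rfl fun q _ => ?_
  rw [← map_pow]
  exact hf (x ^ _) _ _

/-- If a perfect group has a `p`-subgroup of index prime to `p`, invariant homs are trivial. -/
theorem fusion_trivial {N : Type*} [Group N] [Finite N] (hN : commutator N = ⊤)
    {p : ℕ} [Fact p.Prime] (H : Subgroup N) (hH : IsPGroup p H) (hi : ¬ p ∣ H.index)
    {A : Type*} [CommGroup A] (φ : H →* A)
    (hf : ∀ (x : H) (g : N) (hg : g⁻¹ * x * g ∈ H), φ ⟨g⁻¹ * x * g, hg⟩ = φ x) (x : H) :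
    φ x = 1 := by
  have h1 : MonoidHom.transfer φ (x : N) = 1 := by
    have := Abelianization.commutator_subset_ker (MonoidHom.transfer φ)
    rw [hN] at this
    exact this (mem_top _)
  rw [transfer_pow H φ hf] at h1
  obtain ⟨k, hk⟩ := hH x
  have h2 : φ x ^ p ^ k = 1 := by rw [← map_pow, hk, map_one]
  have hc : Nat.Coprime H.index (p ^ k) :=
    (Nat.Coprime.pow_left k ((Nat.Prime.coprime_iff_not_dvd Fact.out).2 hi)).symm
  have := pow_gcd_eq_one.2 ⟨h1, h2⟩
  rwa [hc.gcd_eq_one, pow_one] at this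

/-- The fusion contradiction. -/
theorem fusion_false {G : Type*} [Group G] [Finite G] (N : Subgroup G) [N.Normal]
    (hN : ⁅N, N⁆ = N) {p : ℕ} [Fact p.Prime] (T : Sylow p G) (M : Subgroup G)
    (hTM : (T : Subgroup G) ≤ M)
    (hMT : M ≤ normalizer (T : Set G)) (hM : Group.IsNilpotent M) (hp : p ∣ Nat.card N)
    (hf : ∀ x ∈ T, ∀ g : G, g⁻¹ * x * g ∈ T → ∃ m ∈ M, g⁻¹ * x * g = m⁻¹ * x * m) : False := by
  set P : Subgroup G := T ⊓ N with hP
  set C : Subgroup G := ⁅P, M⁆ with hC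
  have hPM : P ≤ M := inf_le_left.trans hTM
  have hMP : M ≤ normalizer (P : Set G) := by
    intro m hm
    rw [mem_normalizer_iff]
    intro h
    have h1 := mem_normalizer_iff.1 (hMT hm) h
    have h2 : h ∈ N ↔ m * h * m⁻¹ ∈ N := by
      constructor
      · intro hh; exact ‹N.Normal›.conj_mem h hh m
      · intro hh
        have := ‹N.Normal›.conj_mem _ hh m⁻¹
        simpa [mul_assoc] using this
    simp only [hP, mem_inf]
    exact and_congr h1 h2
  have hCP : C ≤ P := by
    rw [hC, ← le_normalizer_iff_commutator_le_left]
    exact hMP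
  -- the subgroup of N
  let H : Subgroup N := (T : Subgroup G).subgroupOf N
  let K : Subgroup H := (C.subgroupOf N).subgroupOf H
  have hcomm : ∀ a b : H, a * b * a⁻¹ * b⁻¹ ∈ K := by
    intro a b
    change ⁅(a : G), (b : G)⁆ ∈ C
    exact commutator_mem_commutator ⟨a.2, a.1.2⟩ (hTM b.2)
  have hKn : K.Normal := by
    constructor
    intro n hn g
    have := K.mul_mem (hcomm g n) hn
    simpa [mul_assoc] using this
  let _ : CommGroup (H ⧸ K) :=
    { (inferInstance : Group (H ⧸ K)) with
      mul_comm := by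
        intro a b
        induction a using QuotientGroup.induction_on with | H a => ?_
        induction b using QuotientGroup.induction_on with | H b => ?_
        rw [← QuotientGroup.mk_mul, ← QuotientGroup.mk_mul, QuotientGroup.eq]
        have := hcomm b⁻¹ a⁻¹
        simpa [mul_assoc] using this }
  have hPN : IsPGroup p H := T.2.comap_of_injective _ N.subtype_injective
  have hidx : ¬ p ∣ H.index := by
    intro h
    apply T.not_dvd_index
    refine h.trans ?_
    change (T : Subgroup G).relIndex N ∣ _
    rw [relIndex_normal_sup]
    exact relIndex_dvd_index_of_le le_sup_left
  have hNp : commutator N = ⊤ := by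
    rw [_root_.commutator_def, ← map_subtype_inj, map_commutator]
    rw [← MonoidHom.range_eq_map, N.range_subtype]
    exact hN
  have key := fusion_trivial hNp H hPN hidx (QuotientGroup.mk' K) (by
    intro x g hg
    obtain ⟨m, hm, hmx⟩ := hf x x.2 g hg
    change (QuotientGroup.mk _ : H ⧸ K) = QuotientGroup.mk x
    rw [eq_comm, QuotientGroup.eq]
    change (x : G)⁻¹ * ((g : G)⁻¹ * x * g) ∈ C
    rw [hmx]
    have : ⁅(x : G)⁻¹, m⁻¹⁆ ∈ C :=
      commutator_mem_commutator (inv_mem ⟨x.2, x.1.2⟩) (inv_mem hm)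
    simpa [commutatorElement_def, mul_assoc] using this)
  have hPC : P ≤ C := by
    intro x hx
    have := key ⟨⟨x, hx.2⟩, hx.1⟩
    have h2 : (⟨⟨x, hx.2⟩, hx.1⟩ : H) ∈ K := (QuotientGroup.eq_one_iff _).1 this
    exact h2
  have hbot := nilp_comm hM hPM hPC
  apply hidx
  have h1 : H = ⊥ := by
    rw [eq_bot_iff]
    intro x hx
    have : (x : G) ∈ P := ⟨hx, x.2⟩
    rw [hbot] at this
    exact Subtype.ext this
  rw [h1, index_bot]
  exact hp


theorem normalizer_grow {G : Type*} [Group G] {D K : Subgroup G} (hK : Group.IsNilpotent K)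
    (h : D < K) : ∃ k ∈ K, k ∉ D ∧ k ∈ normalizer (D : Set G) := by
  have hlt : D.subgroupOf K < ⊤ := by
    rw [lt_top_iff_ne_top, Ne, subgroupOf_eq_top]
    exact not_le_of_gt h
  have := Group.normalizerCondition_of_isNilpotent (G := K) _ hlt
  obtain ⟨k, hk, hk2⟩ := SetLike.exists_of_lt this
  refine ⟨k, k.2, hk2, ?_⟩
  rw [mem_normalizer_iff]
  intro x
  rw [mem_normalizer_iff] at hk
  constructor
  · intro hx
    exact (hk ⟨x, h.le hx⟩).1 hx
  · intro hx
    have hxK : x ∈ K := by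
      have := K.mul_mem (K.mul_mem (K.inv_mem k.2) (h.le hx)) k.2
      simpa [mul_assoc] using this
    exact (hk ⟨x, hxK⟩).2 hx

theorem normalizer_eq_of_core {G : Type*} [Group G] {M X : Subgroup G} (hM : IsCoatom M)
    (hc : M.normalCore = ⊥) (hX : X ≠ ⊥) (hXM : X ≤ M) (hMX : M ≤ normalizer (X : Set G)) :
    normalizer (X : Set G) = M := by
  rcases hM.le_iff.1 hMX with h | h
  · exfalso
    rw [normalizer_eq_top_iff] at h
    have : X ≤ M.normalCore := normal_le_normalCore.2 hXM
    rw [hc] at this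
    exact hX (le_bot_iff.1 this)
  · exact h

theorem hall {G : Type*} [Group G] [Finite G] {M : Subgroup G} (hM : IsCoatom M)
    (hc : M.normalCore = ⊥) (hn : Group.IsNilpotent M) {r : ℕ} [Fact r.Prime]
    (hr : r ∣ Nat.card M) : ∃ T : Sylow r G, normalizer (T : Set G) = M := by
  obtain ⟨S⟩ : Nonempty (Sylow r M) := inferInstance
  have hSn : (S : Subgroup M).Normal :=
    S.normal_of_normalizerCondition Group.normalizerCondition_of_isNilpotent
  set X : Subgroup G := (S : Subgroup M).map M.subtype with hXdef
  have hXM : X ≤ M := map_subtype_le _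
  have hX : X ≠ ⊥ := by
    intro h
    rw [hXdef, map_eq_bot_iff_of_injective _ M.subtype_injective] at h
    exact S.ne_bot_of_dvd_card hr h
  have hMX : M ≤ normalizer (X : Set G) := by
    intro m hm
    rw [mem_normalizer_iff]
    have key : ∀ m' ∈ M, ∀ x ∈ X, m' * x * m'⁻¹ ∈ X := by
      rintro m' hm' _ ⟨s, hs, rfl⟩
      exact ⟨_, hSn.conj_mem s hs ⟨m', hm'⟩, rfl⟩
    intro x
    constructor
    · exact key m hm x
    · intro h
      have := key m⁻¹ (M.inv_mem hm) _ h
      simpa [mul_assoc] using this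
  have hN := normalizer_eq_of_core hM hc hX hXM hMX
  have hXp : IsPGroup r X := S.2.map _
  obtain ⟨T, hT⟩ := hXp.exists_le_sylow
  have hXT : X = T := by
    by_contra hne
    have hlt : X < T := lt_of_le_of_ne hT hne
    obtain ⟨t, htT, htX, htn⟩ := normalizer_grow (T.2.isNilpotent) hlt
    rw [hN] at htn
    have hp : IsPGroup r ((T : Subgroup G).subgroupOf M) :=
      T.2.comap_of_injective _ M.subtype_injective
    have hle : (S : Subgroup M) ≤ (T : Subgroup G).subgroupOf M := by
      intro s hs
      exact hT ⟨s, hs, rfl⟩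
    have := S.3 hp hle
    apply htX
    refine ⟨⟨t, htn⟩, ?_, rfl⟩
    change _ ∈ (S : Subgroup M)
    rw [← this]
    exact htT
  refine ⟨T, ?_⟩
  rw [← hN, hXT]
  rfl

/-- Fusion is controlled by the normalizer of a weakly closed central subgroup. -/
theorem fusion_of_weakly_closed {G : Type*} [Group G] [Finite G] {p : ℕ} [Fact p.Prime]
    (T : Sylow p G) (M W : Subgroup G) (hWT : W ≤ T) (hWc : W ≤ centralizer (T : Set G))
    (hw : ∀ g : G, (∀ w ∈ W, g * w * g⁻¹ ∈ T) → g ∈ M)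
    (x : G) (hx : x ∈ T) (g : G) (hg : g⁻¹ * x * g ∈ T) :
    ∃ m ∈ M, g⁻¹ * x * g = m⁻¹ * x * m := by
  -- `W` and `g W g⁻¹` lie in the centralizer of `x`
  set C : Subgroup G := centralizer {x} with hC
  have hWC : W ≤ C := by
    intro w hw'
    rw [hC, mem_centralizer_singleton_iff]
    exact (mem_centralizer_iff.1 (hWc hw') x hx).symm
  have hWC2 : W.map (MulAut.conj g).toMonoidHom ≤ C := by
    rintro _ ⟨w, hw', rfl⟩
    rw [hC, mem_centralizer_singleton_iff]
    have := mem_centralizer_iff.1 (hWc hw') _ hg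
    have h2 : g * (g⁻¹ * x * g * w) * g⁻¹ = g * (w * (g⁻¹ * x * g)) * g⁻¹ := by rw [this]
    simp only [MulEquiv.coe_toMonoidHom, MulAut.conj_apply]
    simp only [mul_assoc, mul_inv_cancel_left, mul_inv_cancel, mul_one] at h2 ⊢
    exact h2.symm
  have hWp : IsPGroup p W := T.2.to_le hWT
  have hp1 : IsPGroup p (W.subgroupOf C) := hWp.comap_of_injective _ C.subtype_injective
  have hp2 : IsPGroup p ((W.map (MulAut.conj g).toMonoidHom).subgroupOf C) :=
    (hWp.map _).comap_of_injective _ C.subtype_injective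
  obtain ⟨Q1, hQ1⟩ := hp1.exists_le_sylow
  obtain ⟨Q2, hQ2⟩ := hp2.exists_le_sylow
  obtain ⟨c, hc⟩ := exists_smul_eq C Q2 Q1
  obtain ⟨T1, hT1⟩ := (Q1.2.map C.subtype).exists_le_sylow
  obtain ⟨h, hh⟩ := exists_smul_eq G T1 T
  have hT1T : ∀ y ∈ T1, h * y * h⁻¹ ∈ T := by
    intro y hy
    rw [← hh]
    exact ⟨y, hy, rfl⟩
  have e1 : h ∈ M := by
    apply hw
    intro w hw'
    apply hT1T
    exact hT1 ⟨⟨w, hWC hw'⟩, hQ1 hw', rfl⟩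
  have e2 : h * (c * g) ∈ M := by
    apply hw
    intro w hw'
    have h3 : g * w * g⁻¹ ∈ W.map (MulAut.conj g).toMonoidHom := ⟨w, hw', rfl⟩
    have h4 : (⟨g * w * g⁻¹, hWC2 h3⟩ : C) ∈ Q2 := hQ2 h3
    have h5 : c * (⟨g * w * g⁻¹, hWC2 h3⟩ : C) * c⁻¹ ∈ Q1 := by
      rw [← hc]
      exact ⟨_, h4, rfl⟩
    have h6 := hT1T _ (hT1 ⟨_, h5, rfl⟩)
    simpa [mul_assoc] using h6
  have e3 : (c : G) * g ∈ M := by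
    have := M.mul_mem (M.inv_mem e1) e2
    simpa [mul_assoc] using this
  refine ⟨c * g, e3, ?_⟩
  have hcx : (c : G) * x = x * c := mem_centralizer_singleton_iff.1 c.2
  rw [mul_inv_rev]
  have : (c : G)⁻¹ * x * c = x := by rw [mul_assoc, ← hcx, inv_mul_cancel_left]
  calc g⁻¹ * x * g = g⁻¹ * ((c : G)⁻¹ * x * c) * g := by rw [this]
    _ = _ := by simp only [mul_assoc]

theorem comm_mem {G : Type*} [Group G] [Finite G] {p : ℕ} [hp : Fact p.Prime] {X Y : Subgroup G}
    (hY : IsPGroup p Y) (h : X.relIndex Y ∣ p) (a b : G) (ha : a ∈ Y) (hb : b ∈ Y) :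
    a * b * a⁻¹ * b⁻¹ ∈ X := by
  rcases (Nat.dvd_prime hp.out).1 h with h | h
  · rw [relIndex_eq_one] at h
    exact h (Y.mul_mem (Y.mul_mem (Y.mul_mem ha hb) (Y.inv_mem ha)) (Y.inv_mem hb))
  · set X' := X.subgroupOf Y with hX'
    have hi : X'.index = p := h
    obtain ⟨n, hn⟩ := IsPGroup.iff_card.1 hY
    have hn0 : n ≠ 0 := by
      rintro rfl
      have := X'.index_dvd_card
      rw [hi, hn, pow_zero] at this
      exact hp.out.one_lt.ne' (Nat.dvd_one.1 this)
    have hnorm : X'.Normal := by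
      apply normal_of_index_eq_minFac_card
      rw [hi, hn, Nat.pow_minFac hn0, hp.out.minFac_eq]
    have hc : Nat.card (Y ⧸ X') = p := hi
    have hcyc : IsCyclic (Y ⧸ X') := isCyclic_of_prime_card hc
    let a' : Y := ⟨a, ha⟩
    let b' : Y := ⟨b, hb⟩
    have hm : (QuotientGroup.mk (a' * b' * a'⁻¹ * b'⁻¹) : Y ⧸ X') = 1 := by
      have : (QuotientGroup.mk a' : Y ⧸ X') * QuotientGroup.mk b' =
          QuotientGroup.mk b' * QuotientGroup.mk a' := 
        (IsCyclic.isMulCommutative : IsMulCommutative (Y ⧸ X')).is_comm.comm _ _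
      simp only [QuotientGroup.mk_mul, QuotientGroup.mk_inv]
      rw [this]
      group
    have h2 : a' * b' * a'⁻¹ * b'⁻¹ ∈ X' := (QuotientGroup.eq_one_iff _).1 hm
    exact h2

theorem cover {G : Type*} [Group G] [Finite G] {L T : Subgroup G}
    (h : L.relIndex T = L.index) (g : G) : ∃ t ∈ T, ∃ l ∈ L, g = t * l := by
  let f : T ⧸ L.subgroupOf T → G ⧸ L := Quotient.map' (fun t => (t : G)) (by
    intro a b hab
    rw [QuotientGroup.leftRel_apply] at hab ⊢
    exact hab)
  have hinj : Function.Injective f := by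
    intro a b
    induction a using QuotientGroup.induction_on with | H a => ?_
    induction b using QuotientGroup.induction_on with | H b => ?_
    intro hab
    have : (QuotientGroup.mk (a : G) : G ⧸ L) = QuotientGroup.mk (b : G) := hab
    rw [QuotientGroup.eq] at this ⊢
    exact this
  have hbij := hinj.bijective_of_nat_card_le (le_of_eq h.symm)
  obtain ⟨q, hq⟩ := hbij.2 (QuotientGroup.mk g)
  induction q using QuotientGroup.induction_on with | H t => ?_
  have : (QuotientGroup.mk (t : G) : G ⧸ L) = QuotientGroup.mk g := hq
  rw [QuotientGroup.eq] at this
  exact ⟨t, t.2, _, this, by group⟩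

theorem core_triv {G : Type*} [Group G] [Finite G] {L T : Subgroup G} (hc : L.normalCore = ⊥)
    (h : L.relIndex T = L.index) (x : G) (hx : ∀ t ∈ T, t⁻¹ * x * t ∈ L) : x = 1 := by
  have : x ∈ L.normalCore := by
    intro g
    obtain ⟨t, ht, l, hl, e⟩ := cover h g⁻¹
    have hg : g = l⁻¹ * t⁻¹ := by rw [← mul_inv_rev, ← e, inv_inv]
    rw [hg]
    have := L.mul_mem (L.mul_mem (L.inv_mem hl) (hx t ht)) hl
    simpa [mul_assoc] using this
  rw [hc] at this
  exact this

/-- In the primitive situation of degree `p ^ 2`, the normalizer is the Sylow subgroup. -/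
theorem norm_eq_sylow {G : Type*} [Group G] [Finite G] {p : ℕ} [hp : Fact p.Prime] (T : Sylow p G)
    {M L : Subgroup G} (hM : IsCoatom M) (hMc : M.normalCore = ⊥) (hMn : Group.IsNilpotent M)
    (hTM : normalizer (T : Set G) = M) (hLc : L.normalCore = ⊥) (hLi : L.index = p ^ 2)
    (hLT : L.relIndex T = L.index) : M = T := by
  have hTle : (T : Subgroup G) ≤ M := by rw [← hTM]; exact le_normalizer
  have key : ∀ r : ℕ, r.Prime → r ∣ Nat.card M → r = p := by
    intro r hr hrM
    by_contra hne
    have : Fact r.Prime := ⟨hr⟩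
    obtain ⟨R, hR⟩ := hall hM hMc hMn hrM
    have hRle : (R : Subgroup G) ≤ M := by rw [← hR]; exact le_normalizer
    have hdis : Disjoint (R : Subgroup G) (T : Subgroup G) := IsPGroup.disjoint_of_ne r p hne _ _ R.2 T.2
    have hcomm : ∀ x ∈ R, ∀ t ∈ T, x * t = t * x := by
      intro x hx t ht
      have h1 : x * t * x⁻¹ * t⁻¹ ∈ (R : Subgroup G) ⊓ T := by
        constructor
        · have h2 : t ∈ normalizer (R : Set G) := by rw [hR]; exact hTle ht
          have h3 := (mem_normalizer_iff.1 h2 x⁻¹).1 (inv_mem hx)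
          have := (R : Subgroup G).mul_mem hx h3
          have e : x * (t * x⁻¹ * t⁻¹) = x * t * x⁻¹ * t⁻¹ := by group
          rwa [e] at this
        · have h2 : x ∈ normalizer (T : Set G) := by rw [hTM]; exact hRle hx
          have h3 := (mem_normalizer_iff.1 h2 t).1 ht
          exact (T : Subgroup G).mul_mem h3 (inv_mem ht)
      rw [hdis.eq_bot, mem_bot] at h1
      have h2 : x * t * x⁻¹ = t := by simpa using mul_inv_eq_one.1 h1
      exact mul_inv_eq_iff_eq_mul.1 h2
    have hnd : ¬ r ∣ Nat.card (G ⧸ L) := by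
      intro h
      change r ∣ L.index at h
      rw [hLi] at h
      exact hne ((Nat.prime_dvd_prime_iff_eq hr hp.out).1 (hr.dvd_of_dvd_pow h))
    obtain ⟨q, hq⟩ := R.2.nonempty_fixed_point_of_prime_not_dvd_card (G ⧸ L) hnd
    induction q using QuotientGroup.induction_on with | H h => ?_
    have hfix : ∀ x ∈ R, h⁻¹ * x * h ∈ L := by
      intro x hx
      have : (QuotientGroup.mk (x * h) : G ⧸ L) = QuotientGroup.mk h := hq ⟨x, hx⟩
      rw [eq_comm, QuotientGroup.eq] at this
      simpa [mul_assoc] using this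
    obtain ⟨t, ht, l, hl, rfl⟩ := cover hLT h
    have hRL : ∀ x ∈ R, x ∈ L := by
      intro x hx
      have h1 := hfix x hx
      have h2 : t⁻¹ * x * t = x := by rw [mul_assoc, hcomm x hx t ht]; group
      have h3 : (t * l)⁻¹ * x * (t * l) = l⁻¹ * x * l := by
        calc (t * l)⁻¹ * x * (t * l) = l⁻¹ * (t⁻¹ * x * t) * l := by group
          _ = _ := by rw [h2]
      rw [h3] at h1
      have := L.mul_mem (L.mul_mem hl h1) (L.inv_mem hl)
      simpa [mul_assoc] using this
    have hRbot : (R : Subgroup G) = ⊥ := by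
      rw [eq_bot_iff]
      intro x hx
      refine core_triv hLc hLT x fun t ht => ?_
      have h2 : t⁻¹ * x * t = x := by rw [mul_assoc, hcomm x hx t ht]; group
      rw [h2]
      exact hRL x hx
    exact R.ne_bot_of_dvd_card (hrM.trans M.card_subgroup_dvd_card) hRbot
  have hMp : IsPGroup p M := by
    refine IsPGroup.of_card (n := (Nat.card M).primeFactorsList.length) ?_
    exact Nat.eq_prime_pow_of_unique_prime_dvd Nat.card_pos.ne' (fun hd hdv => key _ hd hdv)
  exact T.3 hMp hTle

theorem weak_closure {G : Type*} [Group G] [Finite G] {p : ℕ} [hp : Fact p.Prime] (hp2 : p ≠ 2)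
    (T : Sylow p G) {L : Subgroup G} (hM : IsCoatom (T : Subgroup G))
    (hMc : (T : Subgroup G).normalCore = ⊥)
    (hTM : normalizer (T : Set G) = T) (hLc : L.normalCore = ⊥) (hLi : L.index = p ^ 2)
    (hLT : L.relIndex T = L.index) (hnc : ¬ ∀ a ∈ T, ∀ b ∈ T, a * b = b * a)
    (Z : Subgroup G) (hZ : ∀ z, z ∈ Z ↔ z ∈ T ∧ ∀ t ∈ T, t * z = z * t)
    (g : G) (hg : ∀ w ∈ Z, g * w * g⁻¹ ∈ T) : g ∈ T := by
  -- the abelian subgroup of index `p`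
  obtain ⟨A, hAT, hLA, hAi⟩ : ∃ A : Subgroup G, A ≤ T ∧ L.relIndex A ∣ p ∧ A.relIndex T = p := by
    set T0 : Subgroup T := L.subgroupOf T with hT0
    have hT0i : T0.index = p ^ 2 := hLT.trans hLi
    obtain ⟨n, hn⟩ := IsPGroup.iff_card.1 (T.2.to_subgroup T0)
    have hcT : Nat.card T = p ^ (n + 2) := by
      rw [← T0.card_mul_index, hn, hT0i, pow_add]
    obtain ⟨A, hA, hTA⟩ := Sylow.exists_subgroup_card_pow_succ (G := T) (n := n)
      (by rw [hcT]; exact pow_dvd_pow p (by omega)) hn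
    have hpp : 0 < p ^ n := pow_pos hp.out.pos n
    refine ⟨A.map (T : Subgroup G).subtype, map_subtype_le _, ?_, ?_⟩
    · have h1 : L.relIndex (A.map (T : Subgroup G).subtype) = T0.relIndex A := by
        rw [hT0, subgroupOf, relIndex_comap]
      rw [h1]
      have h2 := T0.card_mul_index
      have h3 := relIndex_mul_index hTA
      have h4 := A.card_mul_index
      have h5 : A.index = p := by
        rw [hA, hcT, show n + 2 = (n + 1) + 1 by ring, pow_succ p (n + 1)] at h4
        exact Nat.eq_of_mul_eq_mul_left (pow_pos hp.out.pos _) h4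
      rw [h5, hT0i, sq] at h3
      rw [Nat.eq_of_mul_eq_mul_right hp.out.pos h3]
    · have h1 : (A.map (T : Subgroup G).subtype).relIndex T = A.index := by
        rw [relIndex, subgroupOf]
        congr 1
        exact comap_map_eq_self_of_injective (T : Subgroup G).subtype_injective A
      rw [h1]
      have h4 := A.card_mul_index
      rw [hA, hcT, show n + 2 = (n + 1) + 1 by ring, pow_succ p (n + 1)] at h4
      exact Nat.eq_of_mul_eq_mul_left (pow_pos hp.out.pos _) h4
  have hAn : ∀ t ∈ T, ∀ a ∈ A, t * a * t⁻¹ ∈ A := by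
    intro t ht a ha
    have := A.mul_mem (comm_mem T.2 hAi.dvd t a ht (hAT ha)) ha
    simpa [mul_assoc] using this
  have hAc : ∀ a ∈ A, ∀ b ∈ A, a * b = b * a := by
    intro a ha b hb
    have : a * b * a⁻¹ * b⁻¹ = 1 := by
      refine core_triv hLc hLT _ fun t ht => ?_
      have h1 := hAn t⁻¹ (inv_mem ht) a ha
      have h2 := hAn t⁻¹ (inv_mem ht) b hb
      have h3 := comm_mem (T.2.to_le hAT) hLA _ _ h1 h2
      have e : t⁻¹ * (a * b * a⁻¹ * b⁻¹) * t = t⁻¹ * a * t⁻¹⁻¹ * (t⁻¹ * b * t⁻¹⁻¹) *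
          (t⁻¹ * a * t⁻¹⁻¹)⁻¹ * (t⁻¹ * b * t⁻¹⁻¹)⁻¹ := by group
      rw [e]
      exact h3
    have h2 : a * b * a⁻¹ = b := by simpa using mul_inv_eq_one.1 this
    exact mul_inv_eq_iff_eq_mul.1 h2
  have hAmax : ∀ x ∈ T, x ∉ A → ∀ c, (∀ a ∈ A, a * c = c * a) → x * c = c * x →
      ∀ t ∈ T, t * c = c * t := by
    intro x hx hxA c hc1 hc2
    set K : Subgroup G := T ⊓ centralizer {c} with hK
    have hAK : A ≤ K := le_inf hAT fun a ha => mem_centralizer_singleton_iff.2 (hc1 a ha)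
    have hKT : K ≤ T := inf_le_left
    have h1 := relIndex_mul_relIndex A K T hAK hKT
    rw [hAi] at h1
    rcases (Nat.dvd_prime hp.out).1 (Dvd.intro _ h1) with h2 | h2
    · rw [relIndex_eq_one] at h2
      exact absurd (h2 ⟨hx, mem_centralizer_singleton_iff.2 hc2⟩) hxA
    · rw [h2] at h1
      have h3 : K.relIndex T = 1 := Nat.eq_of_mul_eq_mul_left hp.out.pos (by rw [h1, mul_one])
      rw [relIndex_eq_one] at h3
      intro t ht
      exact mem_centralizer_singleton_iff.1 (h3 ht).2
  have hZA : Z ≤ A := by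
    intro z hz
    by_contra hzA
    rw [hZ] at hz
    apply hnc
    have h1 : ∀ a ∈ A, ∀ t ∈ T, t * a = a * t := fun a ha =>
      hAmax z hz.1 hzA a (fun b hb => hAc b hb a ha) (hz.2 a (hAT ha)).symm
    intro a ha b hb
    exact hAmax z hz.1 hzA b (fun c hc => (h1 c hc b hb).symm) (hz.2 b hb).symm a ha
  have hZne : Z ≠ ⊥ := by
    intro hbot
    have hTne : Nontrivial T := by
      by_contra h
      rw [not_nontrivial_iff_subsingleton] at h
      apply hnc
      intro a ha b hb
      have e1 : a = 1 := congrArg Subtype.val (Subsingleton.elim (⟨a, ha⟩ : T) 1)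
      have e2 : b = 1 := congrArg Subtype.val (Subsingleton.elim (⟨b, hb⟩ : T) 1)
      rw [e1, e2]
    have := T.2.center_nontrivial
    obtain ⟨z, hz⟩ := exists_ne (1 : center T)
    have : ((z : T) : G) ∈ Z := by
      rw [hZ]
      refine ⟨z.1.2, fun t ht => ?_⟩
      have := (mem_center_iff.1 z.2 ⟨t, ht⟩)
      exact congrArg Subtype.val this
    rw [hbot, mem_bot] at this
    apply hz
    exact Subtype.ext (Subtype.ext this)
  have hZcard : Nat.card Z = p := by
    have hle : Nat.card Z ∣ p ∨ Nat.card Z ≤ p := by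
      right
      have h1 : L.relIndex Z = Nat.card Z := by
        rw [← inf_relIndex_right]
        have : L ⊓ Z = ⊥ := by
          rw [eq_bot_iff]
          rintro z ⟨hzL, hz⟩
          refine core_triv hLc hLT z fun t ht => ?_
          have := ((hZ z).1 hz).2 t ht
          rw [mul_assoc, ← this, inv_mul_cancel_left]
          exact hzL
        rw [this, relIndex_bot_left]
      rw [← h1]
      exact (relIndex_le_of_le_right hZA index_ne_zero_of_finite).trans
        (Nat.le_of_dvd hp.out.pos hLA)
    have hle' : Nat.card Z ≤ p := hle.elim (Nat.le_of_dvd hp.out.pos) id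
    have hZp : IsPGroup p Z := T.2.to_le (hZA.trans hAT)
    rcases hZp.card_eq_or_dvd with h | h
    · exact absurd (card_eq_one.1 h) hZne
    · exact le_antisymm hle' (Nat.le_of_dvd Nat.card_pos h)
  have hZgen : ∀ z ∈ Z, z ≠ 1 → ∀ w ∈ Z, ∃ k : ℤ, z ^ k = w := by
    intro z hz hz1 w hw
    have := mem_zpowers_of_prime_card (G := Z) (p := p) hZcard (g := ⟨z, hz⟩) (g' := ⟨w, hw⟩)
      (fun h => hz1 (congrArg Subtype.val h))
    obtain ⟨k, hk⟩ := mem_zpowers_iff.1 this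
    exact ⟨k, congrArg Subtype.val hk⟩
  have hZn : normalizer (Z : Set G) = T := by
    refine normalizer_eq_of_core hM hMc hZne (hZA.trans hAT) ?_
    intro t ht
    rw [mem_normalizer_iff]
    intro z
    constructor
    · intro hz
      have := ((hZ z).1 hz).2 t ht
      rw [this, mul_inv_cancel_right]
      exact hz
    · intro hz
      have := ((hZ _).1 hz).2 t ht
      have e : t * z * t⁻¹ = z := by
        have h3 : t * (t * z * t⁻¹) = t * z := by rw [this]; group
        exact mul_left_cancel h3
      rwa [e] at hz
  -- anything sending a generator of `Z` into `Z` lies in `T`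
  have hnorm : ∀ z ∈ Z, z ≠ 1 → ∀ c, c * z * c⁻¹ ∈ Z → c ∈ T := by
    intro z hz hz1 c hc
    have h1 : c ∈ normalizer (Z : Set G) := by
      rw [mem_normalizer_iff]
      have hc1 : c * z * c⁻¹ ≠ 1 := by
        intro h
        exact hz1 (conj_eq_one_iff.1 h)
      intro w
      constructor
      · intro hw
        obtain ⟨k, rfl⟩ := hZgen z hz hz1 w hw
        rw [← conj_zpow]
        exact Z.zpow_mem hc k
      · intro hw
        obtain ⟨k, hk⟩ := hZgen _ hc hc1 _ hw
        rw [conj_zpow] at hk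
        have : z ^ k = w := by
          exact mul_left_cancel (mul_right_cancel hk)
        rw [← this]
        exact Z.zpow_mem hz k
    rw [hZn] at h1
    exact h1
  have hcent : ∀ z ∈ Z, z ≠ 1 → ∀ c, c * z = z * c → c ∈ T := by
    intro z hz hz1 c hc
    apply hnorm z hz hz1
    rw [hc, mul_inv_cancel_right]
    exact hz
  have hAN : normalizer (A : Set G) = T := by
    refine normalizer_eq_of_core hM hMc (fun h => hZne (le_bot_iff.1 (h ▸ hZA))) hAT ?_
    intro t ht
    rw [mem_normalizer_iff]
    intro a
    constructor
    · exact hAn t ht a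
    · intro ha
      have := hAn t⁻¹ (inv_mem ht) _ ha
      simpa [mul_assoc] using this
  -- main step
  have hY : ∀ h : G, h ∉ T → ∀ z ∈ Z, z ≠ 1 → h * z * h⁻¹ ∈ T →
      ∃ u ∈ T, ∃ d ∈ Z, d ≠ 1 ∧ u * (h * z * h⁻¹) * u⁻¹ = h * z * h⁻¹ * d := by
    intro h hh z hz hz1 hyT
    set y := h * z * h⁻¹ with hy
    have hyA : y ∉ A := by
      intro hyA
      apply hh
      have hAh : ∀ a ∈ A, h⁻¹ * a * h ∈ T := by
        intro a ha
        apply hcent z hz hz1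
        have h1 := hAc a ha y hyA
        have e1 : z = h⁻¹ * y * h := by rw [hy]; group
        rw [e1]
        calc h⁻¹ * a * h * (h⁻¹ * y * h) = h⁻¹ * (a * y) * h := by group
          _ = h⁻¹ * (y * a) * h := by rw [h1]
          _ = _ := by group
      set A' : Subgroup G := A.map (MulAut.conj h⁻¹).toMonoidHom with hA'
      have hA'T : A' ≤ T := by
        rintro _ ⟨a, ha, rfl⟩
        have e : (MulAut.conj h⁻¹).toMonoidHom a = h⁻¹ * a * h := by simp
        rw [e]
        exact hAh a ha
      have hcA' : Nat.card A' = Nat.card A :=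
        (Nat.card_congr (A.equivMapOfInjective _ (MulAut.conj h⁻¹).injective).toEquiv).symm
      have hA'i : A'.relIndex T = p := by
        have h1 := relIndex_mul_relIndex ⊥ A' T bot_le hA'T
        have h2 := relIndex_mul_relIndex ⊥ A T bot_le hAT
        rw [relIndex_bot_left, relIndex_bot_left] at h1 h2
        rw [hcA', ← h2, hAi] at h1
        exact Nat.eq_of_mul_eq_mul_left Nat.card_pos h1
      have hkey : ∀ t ∈ T, ∀ a ∈ A, (h * t * h⁻¹) * a * (h * t * h⁻¹)⁻¹ ∈ A := by
        intro t ht a ha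
        have ha' : h⁻¹ * a * h ∈ A' := ⟨a, ha, by simp⟩
        have h1 := A'.mul_mem (comm_mem T.2 hA'i.dvd t _ ht (hA'T ha')) ha'
        obtain ⟨b, hb, hbe⟩ := h1
        have : b = (h * t * h⁻¹) * a * (h * t * h⁻¹)⁻¹ := by
          have h3 : h⁻¹ * b * h = t * (h⁻¹ * a * h) * t⁻¹ := by
            have e : (MulAut.conj h⁻¹).toMonoidHom b = h⁻¹ * b * h := by simp
            rw [← e, hbe]
            group
          calc b = h * (h⁻¹ * b * h) * h⁻¹ := by group
            _ = h * (t * (h⁻¹ * a * h) * t⁻¹) * h⁻¹ := by rw [h3]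
            _ = _ := by group
        rw [← this]
        exact hb
      have hconj : ∀ t ∈ T, h * t * h⁻¹ ∈ T := by
        intro t ht
        have : h * t * h⁻¹ ∈ normalizer (A : Set G) := by
          rw [mem_normalizer_iff]
          intro a
          constructor
          · exact hkey t ht a
          · intro ha
            have h1 := hkey t⁻¹ (inv_mem ht) _ ha
            have e : h * t⁻¹ * h⁻¹ * (h * t * h⁻¹ * a * (h * t * h⁻¹)⁻¹) * (h * t⁻¹ * h⁻¹)⁻¹ = a := by
              group
            rwa [e] at h1
        rw [hAN] at this
        exact this
      have hsm : h • T = T := by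
        apply Sylow.ext
        refine (T.2.map (MulAut.conj h).toMonoidHom |> fun _ => ?_)
        apply eq_of_le_of_card_ge
        · rintro _ ⟨t, ht, rfl⟩
          exact hconj t ht
        · rw [Sylow.card_eq_multiplicity, Sylow.card_eq_multiplicity]
      have := Sylow.smul_eq_iff_mem_normalizer.1 hsm
      rw [hTM] at this
      exact this
    set C : Subgroup G := T ⊓ centralizer {y} with hC
    have hCT : C < T := by
      refine lt_of_le_of_ne inf_le_left fun heq => ?_
      apply hyA
      apply hZA
      rw [hZ]
      refine ⟨hyT, fun t ht => ?_⟩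
      have : t ∈ C := by rw [heq]; exact ht
      exact mem_centralizer_singleton_iff.1 this.2
    obtain ⟨u, huT, huC, hun⟩ := normalizer_grow T.2.isNilpotent hCT
    have hyC : y ∈ C := ⟨hyT, mem_centralizer_singleton_iff.2 rfl⟩
    have h1 : u * y * u⁻¹ ∈ C := (mem_normalizer_iff.1 hun y).1 hyC
    have h2 : u * y * u⁻¹ * y⁻¹ ∈ C := C.mul_mem h1 (C.inv_mem hyC)
    have h3 : u * y * u⁻¹ * y⁻¹ ∈ A := comm_mem T.2 hAi.dvd u y huT hyT
    have h4 := mem_centralizer_singleton_iff.1 h2.2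
    have h5 : u * y * u⁻¹ * y⁻¹ ∈ Z := by
      rw [hZ]
      exact ⟨hAT h3, hAmax y hyT hyA _ (fun a ha => hAc a ha _ h3) h4.symm⟩
    refine ⟨u, huT, _, h5, ?_, ?_⟩
    · intro h6
      apply huC
      refine ⟨huT, mem_centralizer_singleton_iff.2 ?_⟩
      have h7 : u * y * u⁻¹ = y := by simpa using mul_inv_eq_one.1 h6
      exact mul_inv_eq_iff_eq_mul.1 h7
    · rw [← h4]; group
  by_contra hgT
  obtain ⟨z0, hz0, hz01⟩ := Z.bot_or_exists_ne_one.resolve_left hZne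
  have hyT := hg z0 hz0
  obtain ⟨u, hu, z, hz, hz1, huy⟩ := hY g hgT z0 hz0 hz01 hyT
  set y := g * z0 * g⁻¹ with hy
  have hxT : g⁻¹ * z * g⁻¹⁻¹ ∈ T := by
    apply hcent z0 hz0 hz01
    have h1 := ((hZ z).1 hz).2 y hyT
    have e1 : z0 = g⁻¹ * y * g := by rw [hy]; group
    rw [e1]
    calc g⁻¹ * z * g⁻¹⁻¹ * (g⁻¹ * y * g) = g⁻¹ * (z * y) * g := by group
      _ = g⁻¹ * (y * z) * g := by rw [h1]
      _ = _ := by group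
  obtain ⟨u2, hu2, ζ, hζ, hζ1, hux⟩ := hY g⁻¹ (fun h => hgT (inv_mem_iff.1 h)) z hz hz1 hxT
  obtain ⟨j, hj⟩ := hZgen ζ hζ hζ1 z0⁻¹ (inv_mem hz0)
  have hpowN : ∀ n : ℕ, u2 ^ n * (g⁻¹ * z * g⁻¹⁻¹) * (u2 ^ n)⁻¹ = g⁻¹ * z * g⁻¹⁻¹ * ζ ^ n := by
    intro n
    induction n with
    | zero => simp
    | succ n ih =>
      have hcz : u2 * ζ ^ n = ζ ^ n * u2 := (Commute.pow_right (((hZ ζ).1 hζ).2 u2 hu2 : Commute u2 ζ) n)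
      calc u2 ^ (n + 1) * (g⁻¹ * z * g⁻¹⁻¹) * (u2 ^ (n + 1))⁻¹
          = u2 * (u2 ^ n * (g⁻¹ * z * g⁻¹⁻¹) * (u2 ^ n)⁻¹) * u2⁻¹ := by
            rw [pow_succ' u2 n]; group
        _ = u2 * (g⁻¹ * z * g⁻¹⁻¹) * (ζ ^ n * u2⁻¹) := by rw [ih]; group
        _ = u2 * (g⁻¹ * z * g⁻¹⁻¹) * (u2⁻¹ * ζ ^ n) := by
            congr 1
            rw [eq_inv_mul_iff_mul_eq, ← mul_assoc, hcz, mul_inv_cancel_right]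
        _ = (u2 * (g⁻¹ * z * g⁻¹⁻¹) * u2⁻¹) * ζ ^ n := by group
        _ = _ := by rw [hux, pow_succ' ζ n, ← mul_assoc]
  obtain ⟨n, hn⟩ : ∃ n : ℕ, ζ ^ n = z0⁻¹ := by
    have : z0⁻¹ ∈ zpowers ζ := mem_zpowers_iff.2 ⟨j, hj⟩
    rw [← mem_powers_iff_mem_zpowers] at this
    exact this
  have hv := hpowN n
  rw [hn] at hv
  set t := u2 ^ n with ht
  have htT : t ∈ T := pow_mem hu2 n
  set v := g * t * g⁻¹ with hvdef
  have hvz : v * z = z * y⁻¹ * v := by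
    calc v * z = g * (t * (g⁻¹ * z * g⁻¹⁻¹) * t⁻¹) * t * g⁻¹ := by rw [hvdef]; group
      _ = g * (g⁻¹ * z * g⁻¹⁻¹ * z0⁻¹) * t * g⁻¹ := by rw [hv]
      _ = _ := by rw [hvdef, hy]; group
  have hvy : v * y = y * v := by
    have := ((hZ z0).1 hz0).2 t htT
    calc v * y = g * (t * z0) * g⁻¹ := by rw [hvdef, hy]; group
      _ = g * (z0 * t) * g⁻¹ := by rw [this]
      _ = _ := by rw [hvdef, hy]; group
  have huz : u * z = z * u := ((hZ z).1 hz).2 u hu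
  have hyz : y * z = z * y := ((hZ z).1 hz).2 y hyT
  have huy' : u * y = y * z * u := mul_inv_eq_iff_eq_mul.1 huy
  have huyi : u * y⁻¹ = z⁻¹ * y⁻¹ * u := by
    rw [← mul_inv_rev, eq_inv_mul_iff_mul_eq, ← mul_assoc, ← huy', mul_inv_cancel_right]
  set w := u * v * u with hw
  have hwz : w * z = y⁻¹ * w := by
    calc w * z = u * v * (u * z) := by rw [hw]; group
      _ = u * (v * z) * u := by rw [huz]; group
      _ = (u * z) * y⁻¹ * v * u := by rw [hvz]; group
      _ = z * (u * y⁻¹) * v * u := by rw [huz]; group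
      _ = y⁻¹ * w := by rw [huyi, hw]; group
  have hwy : w * y = z * w := by
    calc w * y = u * v * (u * y) := by rw [hw]; group
      _ = u * (v * y) * z * u := by rw [huy']; group
      _ = u * y * (v * z) * u := by rw [hvy]; group
      _ = u * (y * z) * y⁻¹ * v * u := by rw [hvz]; group
      _ = u * z * v * u := by rw [hyz]; group
      _ = z * w := by rw [huz, hw]; group
  have hww : (w * w) * z = z⁻¹ * (w * w) := by
    have hwyi : w * y⁻¹ = z⁻¹ * w := by
      rw [eq_inv_mul_iff_mul_eq, ← mul_assoc, ← hwy, mul_inv_cancel_right]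
    calc w * w * z = w * (w * z) := by group
      _ = (w * y⁻¹) * w := by rw [hwz]; group
      _ = _ := by rw [hwyi]; group
  have hwT : w * w ∈ T := by
    apply hnorm z hz hz1
    rw [hww, mul_inv_cancel_right]
    exact inv_mem hz
  have h1 := ((hZ z).1 hz).2 _ hwT
  rw [hww] at h1
  have h2 : z⁻¹ = z := mul_right_cancel h1
  have h3 : z ^ 2 = 1 := by
    rw [sq]; nth_rewrite 1 [← h2]; exact inv_mul_cancel z
  have h4 : z ^ p = 1 := by
    have := pow_card_eq_one' (G := Z) (x := ⟨z, hz⟩)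
    rw [hZcard] at this
    exact congrArg Subtype.val this
  have h5 := pow_gcd_eq_one.2 ⟨h3, h4⟩
  have h6 : Nat.gcd 2 p = 1 := (Nat.coprime_primes Nat.prime_two hp.out).2 hp2.symm
  rw [h6, pow_one] at h5
  exact hz1 h5

theorem solvable_perm_four {α : Type*} [Finite α] (h : Nat.card α = 4) :
    Group.IsSolvable (Equiv.Perm α) := by
  classical
  have := Fintype.ofFinite α
  have hA : Group.IsSolvable (alternatingGroup α) := by
    have h1 := alternatingGroup.kleinFour_eq_commutator h
    have h2 := alternatingGroup.kleinFour_isKleinFour h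
    refine ⟨2, ?_⟩
    rw [derivedSeries_succ, derivedSeries_one, ← h1]
    rw [Subgroup.commutator_eq_bot_iff_le_centralizer]
    intro x hx y hy
    have hc := IsKleinFour.isMulCommutative (G := alternatingGroup.kleinFour α)
    exact congrArg Subtype.val (hc.is_comm.comm ⟨y, hy⟩ ⟨x, hx⟩)
  refine Group.isSolvable_of_ker_le_range (alternatingGroup α).subtype
    (Equiv.Perm.sign (α := α)) ?_
  rw [Subgroup.range_subtype]
  exact le_of_eq rfl

theorem solvable_of_index_four {G : Type*} [Group G] [Finite G] {M : Subgroup G}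
    (hc : M.normalCore = ⊥) (hi : M.index = 4) : Group.IsSolvable G := by
  have := solvable_perm_four (α := G ⧸ M) hi
  refine Group.isSolvable_of_isSolvable_injective (f := MulAction.toPermHom G (G ⧸ M)) ?_
  rw [← MonoidHom.ker_eq_bot_iff, ← normalCore_eq_ker, hc]

theorem index_modEq {H : Type*} [Group H] [Finite H] {p : ℕ} [Fact p.Prime] (P : Sylow p H)
    {U : Subgroup H} (hU : normalizer (P : Set H) ≤ U) : U.index ≡ 1 [MOD p] := by
  have hPU : (P : Subgroup H) ≤ U := le_normalizer.trans hU
  have h1 := card_sylow_modEq_one p H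
  rw [Sylow.card_eq_index_normalizer P, ← relIndex_mul_index hU] at h1
  have h2 := card_sylow_modEq_one p U
  rw [Sylow.card_eq_index_normalizer (P.subtype hPU)] at h2
  have h3 : normalizer ((P.subtype hPU : Subgroup U) : Set U)
      = (normalizer (P : Set H)).subgroupOf U := by
    rw [Sylow.coe_subtype]
    exact (subgroupOf_normalizer_eq hPU).symm
  have h4 : (normalizer (P : Set H)).relIndex U ≡ 1 [MOD p] := by
    rw [relIndex, ← h3]; exact h2
  have h5 := (h4.mul_right U.index).symm.trans h1
  rwa [one_mul] at h5

section
set_option linter.unusedSectionVars false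
variable {G : Type*} [Group G] [Finite G] {N : Subgroup G} [N.Normal]

theorem not_le_solvable (hN : ⁅N, N⁆ = N) (hb : N ≠ ⊥) (K : Subgroup G)
    (hK : Group.IsSolvable K) : ¬ N ≤ K := by
  intro h
  have h1 : N.subgroupOf K ≠ ⊥ := by
    intro h2
    rw [subgroupOf_eq_bot, disjoint_iff, inf_eq_left.2 h] at h2
    exact hb h2
  have h3 := Group.IsSolvable.commutator_lt_of_ne_bot h1
  have h4 := (Subgroup.map_lt_map_iff_of_injective K.subtype_injective).2 h3
  rw [map_commutator, subgroupOf_map_subtype, inf_eq_left.2 h, hN] at h4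
  exact lt_irrefl _ h4

theorem core_bot (hmin : ∀ K : Subgroup G, K.Normal → K ≠ ⊥ → N ≤ K) {L : Subgroup G}
    (h : ¬ N ≤ L) : L.normalCore = ⊥ := by
  by_contra hc
  exact h ((hmin _ inferInstance hc).trans L.normalCore_le)

theorem index_eq {L : Subgroup G} (hL : IsCoatom L) (h : ¬ N ≤ L) : L.index = L.relIndex N := by
  have h1 : L ⊔ N = ⊤ := hL.2 _ (lt_of_le_of_ne le_sup_left fun e => h (e ▸ le_sup_right))
  rw [relIndex_normal_sup, h1, relIndex_top_right]

theorem index_dvd {L : Subgroup G} (hL : IsCoatom L) (h : ¬ N ≤ L) : L.index ∣ Nat.card N := by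
  rw [index_eq hL h]
  exact Subgroup.index_dvd_card _

theorem step1 (hN : ⁅N, N⁆ = N) (hb : N ≠ ⊥)
    (hmin : ∀ K : Subgroup G, K.Normal → K ≠ ⊥ → N ≤ K) {r : ℕ} [hr : Fact r.Prime]
    (hrN : r ∣ Nat.card N) : ∃ M : Subgroup G, IsCoatom M ∧ ¬ N ≤ M ∧ r ∣ Nat.card M ∧
      M.index ≡ 1 [MOD r] := by
  obtain ⟨P⟩ : Nonempty (Sylow r N) := inferInstance
  set Q : Subgroup G := (P : Subgroup N).map N.subtype with hQ
  have hcQ : Nat.card Q = Nat.card P :=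
    (Nat.card_congr ((P : Subgroup N).equivMapOfInjective _ N.subtype_injective).toEquiv).symm
  have hrQ : r ∣ Nat.card Q := by rw [hcQ]; exact P.dvd_card_of_dvd_card hrN
  have hQb : Q ≠ ⊥ := by
    intro h
    rw [h, card_bot] at hrQ
    exact hr.out.one_lt.ne' (Nat.dvd_one.1 hrQ)
  have hQp : IsPGroup r Q := P.2.map _
  have hfr : normalizer (Q : Set G) ⊔ N = ⊤ := P.normalizer_sup_eq_top
  have hnt : normalizer (Q : Set G) ≠ ⊤ := by
    intro h
    have hn := normalizer_eq_top_iff.1 h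
    have := hQp.isNilpotent
    exact not_le_solvable hN hb Q inferInstance (hmin Q hn hQb)
  obtain ⟨M, hM, hle⟩ := (eq_top_or_exists_le_coatom _).resolve_left hnt
  have hNM : ¬ N ≤ M := by
    intro h
    apply hM.1
    rw [eq_top_iff, ← hfr]
    exact sup_le hle h
  refine ⟨M, hM, hNM, hrQ.trans (card_dvd_of_le (le_normalizer.trans hle)), ?_⟩
  rw [index_eq hM hNM]
  refine index_modEq P (U := M.subgroupOf N) ?_
  have h1 := (P : Subgroup N).le_normalizer_map N.subtype
  intro x hx
  exact hle (h1 ⟨x, hx, rfl⟩)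
end

theorem arith {p q n : ℕ} (hp : p.Prime) (hp2 : p ≠ 2) (hq : q.Prime) (hqp : q ≤ p)
    (hn : n = q ∨ n = q ^ 2) (h : n ≡ 1 [MOD p]) : n = 4 := by
  have hq2 := hq.two_le
  have hne : q ≠ p := by
    rintro rfl
    have h0 : n ≡ 0 [MOD q] := by
      rw [Nat.modEq_zero_iff_dvd]
      rcases hn with rfl | rfl
      · exact dvd_rfl
      · exact dvd_pow_self _ two_ne_zero
    have h1 := (Nat.modEq_zero_iff_dvd.1 (h.symm.trans h0))
    exact hp.one_lt.ne' (Nat.dvd_one.1 h1)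
  have hlt : q < p := lt_of_le_of_ne hqp hne
  rcases hn with rfl | rfl
  · have := Nat.ModEq.eq_of_lt_of_lt h hlt hp.one_lt
    omega
  · obtain ⟨k, rfl⟩ : ∃ k, q = k + 1 := ⟨q - 1, by omega⟩
    have h1 : p ∣ (k + 1) ^ 2 - 1 := (Nat.modEq_iff_dvd' (Nat.one_le_pow _ _ (by omega))).1 h.symm
    have h2 : (k + 1) ^ 2 - 1 = k * (k + 2) := by
      have : (k + 1) ^ 2 = k * (k + 2) + 1 := by ring
      omega
    rw [h2] at h1
    rcases (hp.dvd_mul).1 h1 with h3 | h3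
    · have := Nat.le_of_dvd (by omega) h3
      omega
    · have := Nat.le_of_dvd (by omega) h3
      have hpe : p = k + 2 := by omega
      have h4 := hp.eq_two_or_odd
      have h5 := hq.eq_two_or_odd
      have : k = 1 := by omega
      subst this
      norm_num

section
set_option linter.unusedSectionVars false
variable {G : Type*} [Group G] [Finite G] {N : Subgroup G} [N.Normal]

theorem step2 (hN : ⁅N, N⁆ = N) (hb : N ≠ ⊥)
    (hmin : ∀ K : Subgroup G, K.Normal → K ≠ ⊥ → N ≤ K)
    (hyp : ∀ M : Subgroup G, IsCoatom M →
      Group.IsNilpotent M ∨ ∃ q : ℕ, q.Prime ∧ (M.index = q ∨ M.index = q ^ 2)) :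
    ∃ p : ℕ, ∃ _ : Fact p.Prime, p ≠ 2 ∧ p ∣ Nat.card N ∧
      (∀ q : ℕ, q.Prime → q ∣ Nat.card N → q ≤ p) ∧
      ∃ T : Sylow p G, IsCoatom (normalizer (T : Set G)) ∧
        (normalizer (T : Set G)).normalCore = ⊥ ∧
        Group.IsNilpotent (normalizer (T : Set G)) := by
  have hc1 : Nat.card N ≠ 1 := fun h => hb (card_eq_one.1 h)
  have hc0 : Nat.card N ≠ 0 := Nat.card_pos.ne'
  have hne : (Nat.card N).primeFactors.Nonempty := by
    rw [Nat.nonempty_primeFactors]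
    omega
  set p := (Nat.card N).primeFactors.max' hne with hpdef
  have hpm : p ∈ (Nat.card N).primeFactors := Finset.max'_mem _ _
  have hpp : p.Prime := Nat.prime_of_mem_primeFactors hpm
  have hpd : p ∣ Nat.card N := Nat.dvd_of_mem_primeFactors hpm
  have hmax : ∀ q : ℕ, q.Prime → q ∣ Nat.card N → q ≤ p := fun q hq hqd =>
    Finset.le_max' _ _ (Nat.mem_primeFactors.2 ⟨hq, hqd, hc0⟩)
  have : Fact p.Prime := ⟨hpp⟩
  have hp2 : p ≠ 2 := by
    intro h2
    have h3 : Nat.card N = 2 ^ (Nat.card N).primeFactorsList.length :=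
      Nat.eq_prime_pow_of_unique_prime_dvd hc0 fun {q} hq hqd =>
        le_antisymm (h2 ▸ hmax q hq hqd) hq.two_le
    have : Fact (Nat.Prime 2) := ⟨Nat.prime_two⟩
    have := (IsPGroup.of_card h3).isNilpotent
    exact not_le_solvable hN hb N inferInstance le_rfl
  obtain ⟨M, hM, hNM, hpM, hmod⟩ := step1 hN hb hmin hpd
  have hcore := core_bot hmin hNM
  have hnil : Group.IsNilpotent M := by
    refine (hyp M hM).resolve_right ?_
    rintro ⟨q, hq, hqi⟩
    have hqd : q ∣ Nat.card N := by
      refine dvd_trans ?_ (index_dvd hM hNM)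
      rcases hqi with h | h <;> rw [h]
      exact dvd_pow_self _ two_ne_zero
    have h4 := arith hpp hp2 hq (hmax q hq hqd) hqi hmod
    have := solvable_of_index_four hcore h4
    exact not_le_solvable hN hb N inferInstance le_rfl
  obtain ⟨T, hT⟩ := hall hM hcore hnil hpM
  refine ⟨p, ⟨hpp⟩, hp2, hpd, hmax, T, ?_⟩
  rw [hT]
  exact ⟨hM, hcore, hnil⟩

theorem caseA (hN : ⁅N, N⁆ = N) {p : ℕ} [hp : Fact p.Prime] (hp2 : p ≠ 2)
    (hpd : p ∣ Nat.card N) (T : Sylow p G) {M : Subgroup G} (hTM : normalizer (T : Set G) = M)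
    (hM : IsCoatom M) (hMc : M.normalCore = ⊥) (hMn : Group.IsNilpotent M)
    {L : Subgroup G} (hLc : L.normalCore = ⊥) {q : ℕ} (hqp : q ≤ p)
    (hL : L.index = q ∨ L.index = q ^ 2) : False := by
  have hTM' : (T : Subgroup G) ≤ M := hTM ▸ le_normalizer
  set W : Subgroup G := T ⊓ centralizer (T : Set G) with hW
  have hWT : W ≤ T := inf_le_left
  have hWc : W ≤ centralizer (T : Set G) := inf_le_right
  have hWm : ∀ z, z ∈ W ↔ z ∈ T ∧ ∀ t ∈ T, t * z = z * t := by
    intro z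
    rw [hW, mem_inf, mem_centralizer_iff]
    rfl
  suffices hw : ∀ g, (∀ w ∈ W, g * w * g⁻¹ ∈ T) → g ∈ M by
    exact fusion_false N hN T M hTM' hTM.ge hMn hpd
      (fun x hx g hg => fusion_of_weakly_closed T M W hWT hWc hw x hx g hg)
  by_cases hab : ∀ a ∈ T, ∀ b ∈ T, a * b = b * a
  · intro g hg
    have hTW : ∀ t ∈ T, t ∈ W := fun t ht => (hWm t).2 ⟨ht, fun s hs => hab s hs t ht⟩
    rw [← hTM]
    apply Sylow.smul_eq_iff_mem_normalizer.1
    apply Sylow.ext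
    apply eq_of_le_of_card_ge
    · rintro _ ⟨t, ht, rfl⟩
      exact hg t (hTW t ht)
    · rw [Sylow.card_eq_multiplicity, Sylow.card_eq_multiplicity]
  · have hle : L.index ≤ p ^ 2 := by
      rcases hL with h | h <;> rw [h]
      · exact hqp.trans (Nat.le_self_pow two_ne_zero p)
      · exact Nat.pow_le_pow_left hqp 2
    -- a conjugate of `L` with large index in `T`
    obtain ⟨g, hg⟩ : ∃ g : G, ¬ (L.map (MulAut.conj g).toMonoidHom).relIndex T ∣ p := by
      by_contra hcon
      push Not at hcon
      apply hab
      intro a ha b hb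
      have h1 : a * b * a⁻¹ * b⁻¹ ∈ L.normalCore := by
        intro g
        obtain ⟨l, hl, hle⟩ := comm_mem T.2 (hcon g⁻¹) a b ha hb
        have : l = g * (a * b * a⁻¹ * b⁻¹) * g⁻¹ := by
          rw [← hle]
          simp
          group
        rw [← this]
        exact hl
      rw [hLc, mem_bot] at h1
      have h2 : a * b * a⁻¹ = b := by simpa using mul_inv_eq_one.1 h1
      exact mul_inv_eq_iff_eq_mul.1 h2
    set L' := L.map (MulAut.conj g).toMonoidHom with hL'
    have hLi : L'.index = L.index :=
      index_map_of_bijective (f := (MulAut.conj g).toMonoidHom) (MulAut.conj g).bijective L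
    have hLc' : L'.normalCore = ⊥ := by
      rw [eq_bot_iff, ← hLc]
      intro x hx h
      obtain ⟨l, hl, hle⟩ := hx (g * h)
      have : l = h * x * h⁻¹ := by
        have e : (MulAut.conj g).toMonoidHom l = g * l * g⁻¹ := by simp
        rw [e] at hle
        have : l = g⁻¹ * (g * l * g⁻¹) * g := by group
        rw [this, hle]
        group
      rw [← this]
      exact hl
    have hpow : ∃ k, L'.relIndex T = p ^ k := by
      obtain ⟨k, hk⟩ := IsPGroup.iff_card.1 T.2
      have h1 : L'.relIndex T ∣ p ^ k := by
        rw [← hk]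
        exact Subgroup.index_dvd_card _
      obtain ⟨m, -, hm⟩ := (Nat.dvd_prime_pow hp.out).1 h1
      exact ⟨m, hm⟩
    obtain ⟨k, hk⟩ := hpow
    have hk2 : 2 ≤ k := by
      by_contra hlt
      apply hg
      rw [hk]
      have : k ≤ 1 := by omega
      simpa using pow_dvd_pow p this
    have hri : L'.relIndex T ≤ L'.index := by
      rw [← relIndex_top_right L']
      exact relIndex_le_of_le_right le_top (by rw [relIndex_top_right]; exact index_ne_zero_of_finite)
    have h2k : p ^ 2 ≤ L'.relIndex T := by
      rw [hk]; exact Nat.pow_le_pow_right hp.out.pos hk2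
    have hi2 : L'.index = p ^ 2 := le_antisymm (hLi ▸ hle) (h2k.trans hri)
    have hir : L'.relIndex T = L'.index := le_antisymm hri (hi2 ▸ h2k)
    have hMT : M = T := norm_eq_sylow T hM hMc hMn hTM hLc' hi2 hir
    subst hMT
    exact fun g hg => weak_closure hp2 T hM hMc hTM hLc' hi2 hir hab W hWm g hg
end

theorem coatoms_ti {G : Type*} [Group G] [Finite G]
    (hs : ∀ K : Subgroup G, K.Normal → K ≠ ⊥ → K = ⊤)
    (hB : ∀ L : Subgroup G, IsCoatom L → Group.IsNilpotent L) :
    ∀ D M₁ M₂ : Subgroup G, IsCoatom M₁ → IsCoatom M₂ → M₁ ≠ M₂ → M₁ ⊓ M₂ = D → D = ⊥ := by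
  intro D
  induction D using WellFoundedGT.induction with
  | ind D ih =>
    intro M₁ M₂ h₁ h₂ hne hD
    by_contra hDb
    have hD1 : D < M₁ := by
      refine lt_of_le_of_ne (hD ▸ inf_le_left) fun e => ?_
      rw [e, inf_eq_left] at hD
      exact hne (h₁.le_iff_eq h₂.1 |>.1 hD).symm
    have hD2 : D < M₂ := by
      refine lt_of_le_of_ne (hD ▸ inf_le_right) fun e => ?_
      rw [e, inf_eq_right] at hD
      exact hne (h₂.le_iff_eq h₁.1 |>.1 hD)
    have hnt : normalizer (D : Set G) ≠ ⊤ := by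
      intro h
      have h3 := hs D (normalizer_eq_top_iff.1 h) hDb
      rw [h3] at hD1
      exact not_top_lt hD1
    obtain ⟨L, hL, hle⟩ := (eq_top_or_exists_le_coatom _).resolve_left hnt
    have key : ∀ K : Subgroup G, IsCoatom K → D < K → L = K := by
      intro K hK hDK
      by_contra hLK
      obtain ⟨k, hk, hkD, hkn⟩ := normalizer_grow (hB K hK) hDK
      have hlt : D < L ⊓ K := by
        refine lt_of_le_of_ne (le_inf (le_normalizer.trans hle) hDK.le) fun e => hkD ?_
        rw [e]
        exact ⟨hle hkn, hk⟩
      have := ih _ hlt L K hL hK hLK rfl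
      rw [this] at hlt
      exact not_lt_bot hlt
    exact hne ((key M₁ h₁ hD1).symm.trans (key M₂ h₂ hD2))

section
set_option linter.unusedSectionVars false
variable {G : Type*} [Group G] [Finite G] {N : Subgroup G} [N.Normal]

theorem caseB_top (hN : ⁅N, N⁆ = N) (hb : N ≠ ⊥)
    (hmin : ∀ K : Subgroup G, K.Normal → K ≠ ⊥ → N ≤ K)
    (hB : ∀ L : Subgroup G, IsCoatom L → ¬ N ≤ L → Group.IsNilpotent L) : N = ⊤ := by
  by_contra hNt
  obtain ⟨s, hs, hsd⟩ := Nat.exists_prime_and_dvd (mt index_eq_one.1 hNt)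
  have : Fact s.Prime := ⟨hs⟩
  have hidx : ∀ L : Subgroup G, IsCoatom L → ¬ N ≤ L → L.index = Nat.card (Sylow s G) := by
    intro L hL hNL
    have h1 : L ⊔ N = ⊤ := hL.2 _ (lt_of_le_of_ne le_sup_left fun e => hNL (e ▸ le_sup_right))
    have h2 : N.relIndex L = N.index := by
      rw [← relIndex_sup_right, h1, relIndex_top_right]
    have h3 : s ∣ Nat.card L := by
      refine dvd_trans ?_ (Subgroup.index_dvd_card (N.subgroupOf L))
      change s ∣ N.relIndex L
      rw [h2]
      exact hsd
    obtain ⟨S, hS⟩ := hall hL (core_bot hmin hNL) (hB L hL hNL) h3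
    rw [Sylow.card_eq_index_normalizer S, hS]
  have hc1 : Nat.card N ≠ 1 := fun h => hb (card_eq_one.1 h)
  obtain ⟨r0, hr0, hr0d⟩ := Nat.exists_prime_and_dvd hc1
  have : Fact r0.Prime := ⟨hr0⟩
  obtain ⟨M0, hM0, hNM0, -, -⟩ := step1 hN hb hmin hr0d
  obtain ⟨r, hr, hrd⟩ := Nat.exists_prime_and_dvd (mt index_eq_one.1 hM0.1)
  have : Fact r.Prime := ⟨hr⟩
  obtain ⟨M, hM, hNM, -, hmod⟩ := step1 hN hb hmin (hrd.trans (index_dvd hM0 hNM0))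
  rw [hidx M hM hNM, ← hidx M0 hM0 hNM0] at hmod
  have h1 := Nat.modEq_zero_iff_dvd.1 (hmod.symm.trans (Nat.modEq_zero_iff_dvd.2 hrd))
  exact hr.one_lt.ne' (Nat.dvd_one.1 h1)

theorem caseB (hN : ⁅N, N⁆ = N) (hb : N ≠ ⊥)
    (hmin : ∀ K : Subgroup G, K.Normal → K ≠ ⊥ → N ≤ K)
    (hB : ∀ L : Subgroup G, IsCoatom L → ¬ N ≤ L → Group.IsNilpotent L)
    {p : ℕ} [hp : Fact p.Prime] (hpd : p ∣ Nat.card N) (T : Sylow p G) {M : Subgroup G}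
    (hTM : normalizer (T : Set G) = M) (hM : IsCoatom M) (hMc : M.normalCore = ⊥)
    (hMn : Group.IsNilpotent M) : False := by
  have hNt := caseB_top hN hb hmin hB
  have hTM' : (T : Subgroup G) ≤ M := hTM ▸ le_normalizer
  refine fusion_false N hN T M hTM' hTM.ge hMn hpd ?_
  intro x hx g hg
  by_cases hx1 : x = 1
  · exact ⟨1, M.one_mem, by rw [hx1]; group⟩
  refine ⟨g, ?_, rfl⟩
  set M' : Subgroup G := M.comap ((MulAut.conj g⁻¹ : G ≃* G) : G →* G) with hM'
  have hM'c : IsCoatom M' := (Subgroup.isCoatom_comap (MulAut.conj g⁻¹)).2 hM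
  have hmem : ∀ y, y ∈ M' ↔ g⁻¹ * y * g ∈ M := by
    intro y
    rw [hM', mem_comap]
    simp
  have hMM : M = M' := by
    by_contra hne
    have := coatoms_ti (fun K hK hKb => top_le_iff.1 (hNt ▸ hmin K hK hKb))
      (fun L hL => hB L hL (fun h => hL.1 (top_le_iff.1 (hNt ▸ h)))) _ M M' hM hM'c hne rfl
    have hxm : x ∈ M ⊓ M' := ⟨hTM' hx, (hmem x).2 (hTM' hg)⟩
    rw [this, mem_bot] at hxm
    exact hx1 hxm
  have hMb : M ≠ ⊥ := by
    intro h
    have := hTM' hx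
    rw [h, mem_bot] at this
    exact hx1 this
  have hn := normalizer_eq_of_core hM hMc hMb le_rfl le_normalizer
  have : g⁻¹ ∈ normalizer (M : Set G) := by
    rw [mem_normalizer_iff]
    intro y
    rw [inv_inv, ← hmem, ← hMM]
  rw [hn] at this
  exact inv_mem_iff.1 this

theorem main_lemma (hN : ⁅N, N⁆ = N) (hb : N ≠ ⊥)
    (hmin : ∀ K : Subgroup G, K.Normal → K ≠ ⊥ → N ≤ K)
    (hyp : ∀ M : Subgroup G, IsCoatom M →
      Group.IsNilpotent M ∨ ∃ q : ℕ, q.Prime ∧ (M.index = q ∨ M.index = q ^ 2)) : False := by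
  obtain ⟨p, hpF, hp2, hpd, hmax, T, hM, hMc, hMn⟩ := step2 hN hb hmin hyp
  by_cases hB : ∀ L : Subgroup G, IsCoatom L → ¬ N ≤ L → Group.IsNilpotent L
  · exact caseB hN hb hmin hB hpd T rfl hM hMc hMn
  · push Not at hB
    obtain ⟨L, hL, hNL, hLn⟩ := hB
    obtain ⟨q, hq, hqi⟩ := (hyp L hL).resolve_left hLn
    have hqd : q ∣ Nat.card N := by
      refine dvd_trans ?_ (index_dvd hL hNL)
      rcases hqi with h | h <;> rw [h]
      exact dvd_pow_self _ two_ne_zero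
    exact caseA hN hp2 hpd T rfl hM hMc hMn (core_bot hmin hNL) (hmax q hq hqd) hqi
end

universe u

theorem main_induction (n : ℕ) : ∀ (G : Type u) [Group G] [Finite G], Nat.card G = n →
    (∀ M : Subgroup G, IsCoatom M →
      Group.IsNilpotent M ∨ ∃ q : ℕ, q.Prime ∧ (M.index = q ∨ M.index = q ^ 2)) →
    Group.IsSolvable G := by
  induction n using Nat.strong_induction_on with
  | _ n ih =>
    intro G _ _ hG hyp
    by_contra hns
    have hquot : ∀ (K : Subgroup G) [K.Normal], K ≠ ⊥ → Group.IsSolvable (G ⧸ K) := by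
      intro K _ hK
      refine ih (Nat.card (G ⧸ K)) ?_ (G ⧸ K) rfl ?_
      · rw [← hG, ← index_eq_card, ← K.card_mul_index]
        have h1 : 1 < Nat.card K := by
          have h0 := Nat.card_pos (α := K)
          have h2 : Nat.card K ≠ 1 := fun h => hK (card_eq_one.1 h)
          omega
        have h2 : 0 < K.index := Nat.pos_of_ne_zero index_ne_zero_of_finite
        nlinarith
      · intro M hM
        have hsurj := QuotientGroup.mk'_surjective K
        have hMc := Subgroup.isCoatom_comap_of_surjective hsurj hM
        rcases hyp _ hMc with h | ⟨q, hq, hqi⟩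
        · left
          have hs : Function.Surjective ((QuotientGroup.mk' K).subgroupComap M) :=
            (QuotientGroup.mk' K).subgroupComap_surjective_of_surjective M hsurj
          exact Group.nilpotent_of_surjective _ hs
        · right
          rw [index_comap_of_surjective _ hsurj] at hqi
          exact ⟨q, hq, hqi⟩
    obtain ⟨_, ⟨m, rfl⟩, hm⟩ := (wellFounded_lt (α := Subgroup G)).has_min
      (Set.range (derivedSeries G)) ⟨_, 0, rfl⟩
    have hstab : derivedSeries G (m + 1) = derivedSeries G m := by
      by_contra hne
      exact hm _ ⟨m + 1, rfl⟩
        (lt_of_le_of_ne (derivedSeries_antitone G (Nat.le_succ m)) hne)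
    have hge : ∀ k, derivedSeries G m ≤ derivedSeries G k := by
      intro k
      have h1 : derivedSeries G (max m k) ≤ derivedSeries G m :=
        derivedSeries_antitone G (le_max_left _ _)
      have h2 : derivedSeries G (max m k) = derivedSeries G m := by
        by_contra hne
        exact hm _ ⟨_, rfl⟩ (lt_of_le_of_ne h1 hne)
      rw [← h2]
      exact derivedSeries_antitone G (le_max_right _ _)
    have := derivedSeries_normal G m
    refine main_lemma (N := derivedSeries G m) ?_ ?_ ?_ hyp
    · rw [← derivedSeries_succ]
      exact hstab
    · intro h
      exact hns ⟨m, h⟩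
    · intro K hKn hK
      obtain ⟨k, hk⟩ := hquot K hK
      refine (hge k).trans ?_
      have h1 := map_derivedSeries_le_derivedSeries (QuotientGroup.mk' K) k
      rw [hk, le_bot_iff, Subgroup.map_eq_bot_iff, QuotientGroup.ker_mk'] at h1
      exact h1

end PrimeSq

theorem stmt_0 {G : Type*} [Group G] [Finite G]
    (h : ∀ M : Subgroup G, IsCoatom M →
      Group.IsNilpotent M ∨ ∃ q : ℕ, q.Prime ∧ (M.index = q ∨ M.index = q ^ 2)) :
    IsSolvable G := by
  exact PrimeSq.main_induction (Nat.card G) G rfl h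
end

section
/- Let G be a finite group, N a non-solvable minimal normal subgroup of G, p an odd prime dividing |N|, and P a Sylow p-subgroup of N. Then there exists a maximal subgroup M of G such that M contains the normalizer N_G(P), M does not contain N, and M is not p-nilpotent. -/
/-- A group is `p`-nilpotent if it has a normal `p`-complement, i.e. a normal subgroup
that is a complement to every (equivalently, some) Sylow `p`-subgroup. -/
def IsPNilpotent (p : ℕ) (G : Type*) [Group G] : Prop :=
  ∃ N : Subgroup G, N.Normal ∧ ∀ P : Sylow p G, Subgroup.IsComplement' N P

namespace Th

open Subgroup

/-- `x` is an element of order prime to `p`. -/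
def PE (p : ℕ) {G : Type*} [Group G] (x : G) : Prop := (orderOf x).Coprime p

/-- elementwise form of `p`-nilpotency of a subgroup: the p-regular elements are closed under products -/
def PN (p : ℕ) {G : Type*} [Group G] (H : Subgroup G) : Prop :=
  ∀ x ∈ H, ∀ y ∈ H, PE p x → PE p y → PE p (x * y)

section basic

variable {p : ℕ} {G : Type*} [Group G] {G' : Type*} [Group G']

lemma PE.one : PE p (1 : G) := by simp [PE]

lemma PE.inv {x : G} (h : PE p x) : PE p x⁻¹ := by simpa [PE] using h

lemma PE.map {x : G} (h : PE p x) (f : G →* G') : PE p (f x) :=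
  Nat.Coprime.coprime_dvd_left (orderOf_map_dvd f x) h

lemma PE.conj {x : G} (h : PE p x) (g : G) : PE p (g * x * g⁻¹) := by
  simpa using h.map (MulAut.conj g).toMonoidHom

lemma PE.of_inj {x : G} {f : G →* G'} (hf : Function.Injective f) (h : PE p (f x)) : PE p x := by
  rwa [PE, orderOf_injective f hf] at h

lemma PE.pow {x : G} (h : PE p x) (n : ℕ) : PE p (x ^ n) :=
  Nat.Coprime.coprime_dvd_left (orderOf_pow_dvd n) h

lemma PE.coe {H : Subgroup G} {x : H} (h : PE p x) : PE p (x : G) := h.map H.subtype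

lemma PE.sub {H : Subgroup G} {x : H} (h : PE p (x : G)) : PE p x :=
  PE.of_inj (f := H.subtype) H.subtype_injective h

lemma PE.eq_one_of_pow [Fact p.Prime] {x : G} (h : PE p x) {n : ℕ} (hx : x ^ p ^ n = 1) : x = 1 := by
  have h1 : orderOf x ∣ p ^ n := orderOf_dvd_of_pow_eq_one hx
  have h2 : (orderOf x).Coprime (p ^ n) := Nat.Coprime.pow_right n h
  exact orderOf_eq_one_iff.1 (Nat.Coprime.eq_one_of_dvd h2 h1)

lemma PE.eq_one [Fact p.Prime] {x : G} (h : PE p x) {H : Subgroup G} (hH : IsPGroup p H)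
    (hx : x ∈ H) : x = 1 := by
  obtain ⟨n, hn⟩ := hH ⟨x, hx⟩
  exact h.eq_one_of_pow (n := n) (by simpa using congrArg Subtype.val hn)

lemma PE.of_card {x : G} {H : Subgroup G} (hH : (Nat.card H).Coprime p) (hx : x ∈ H) : PE p x := by
  have := orderOf_dvd_natCard (⟨x, hx⟩ : H)
  rw [Subgroup.orderOf_mk] at this
  exact Nat.Coprime.coprime_dvd_left this hH

lemma PE.of_qgroup [hp : Fact p.Prime] {q : ℕ} [hq : Fact q.Prime] (hpq : q ≠ p)
    {T : Subgroup G} (hT : IsPGroup q T) {x : G} (hx : x ∈ T) : PE p x := by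
  obtain ⟨k, hk⟩ := IsPGroup.iff_orderOf.1 hT ⟨x, hx⟩
  rw [Subgroup.orderOf_mk] at hk
  rw [PE, hk]
  exact Nat.Coprime.pow_left _ ((Nat.coprime_primes hq.1 hp.1).2 hpq)

/-- a power of `p` makes an element a p-regular element -/
lemma exists_pow_PE [hp : Fact p.Prime] [Finite G] (x : G) : ∃ a, PE p (x ^ p ^ a) := by
  obtain ⟨a, m, hm, h⟩ := Nat.exists_eq_pow_mul_and_not_dvd (orderOf_pos x).ne' p hp.1.ne_one
  refine ⟨a, ?_⟩
  have : orderOf (x ^ p ^ a) ∣ m := by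
    apply orderOf_dvd_of_pow_eq_one
    rw [← pow_mul, ← h, pow_orderOf_eq_one]
  exact Nat.Coprime.coprime_dvd_left this ((Nat.Prime.coprime_iff_not_dvd hp.1).2 hm).symm

lemma PE.lift [hp : Fact p.Prime] [Finite G] (f : G →* G') (x : G) (h : PE p (f x)) :
    ∃ y ∈ zpowers x, PE p y ∧ f y = f x := by
  obtain ⟨a, ha⟩ := exists_pow_PE (p := p) x
  have h2 : (p ^ a).Coprime (orderOf (f x)) := (Nat.Coprime.pow_right a h).symm
  obtain ⟨k, hk⟩ := exists_pow_eq_self_of_coprime h2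
  refine ⟨(x ^ p ^ a) ^ k, ?_, ha.pow k, by simpa using hk⟩
  exact pow_mem (pow_mem (mem_zpowers x) _) _

lemma PN.mono {H K : Subgroup G} (h : PN p K) (hHK : H ≤ K) : PN p H :=
  fun x hx y hy => h x (hHK hx) y (hHK hy)

lemma PN.map [Fact p.Prime] [Finite G] {H : Subgroup G} (h : PN p H) (f : G →* G') :
    PN p (H.map f) := by
  rintro _ ⟨x, hx, rfl⟩ _ ⟨y, hy, rfl⟩ h1 h2
  obtain ⟨x', hx', h1', e1⟩ := PE.lift f x h1
  obtain ⟨y', hy', h2', e2⟩ := PE.lift f y h2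
  rw [← e1, ← e2, ← _root_.map_mul]
  exact (h x' (zpowers_le.2 hx hx') y' (zpowers_le.2 hy hy') h1' h2').map f

lemma PN.comap {f : G →* G'} (hf : Function.Injective f) {H : Subgroup G'} (h : PN p H) :
    PN p (H.comap f) := by
  intro x hx y hy h1 h2
  refine PE.of_inj hf ?_
  rw [_root_.map_mul]
  exact h _ hx _ hy (h1.map f) (h2.map f)

lemma PN.of_top {M : Subgroup G} (h : PN p (⊤ : Subgroup M)) : PN p M := by
  intro x hx y hy h1 h2
  exact (h ⟨x, hx⟩ trivial ⟨y, hy⟩ trivial (PE.sub h1) (PE.sub h2)).coe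

/-- The subgroup of p-regular elements. -/
def PN.core {H : Subgroup G} (h : PN p H) : Subgroup G where
  carrier := {x | x ∈ H ∧ PE p x}
  one_mem' := ⟨H.one_mem, PE.one⟩
  mul_mem' := fun ha hb => ⟨H.mul_mem ha.1 hb.1, h _ ha.1 _ hb.1 ha.2 hb.2⟩
  inv_mem' := fun ha => ⟨H.inv_mem ha.1, ha.2.inv⟩

lemma PN.mem_core {H : Subgroup G} (h : PN p H) {x : G} : x ∈ h.core ↔ x ∈ H ∧ PE p x := Iff.rfl

lemma PN.core_normal {H : Subgroup G} [H.Normal] (h : PN p H) : h.core.Normal :=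
  ⟨fun _ hx g => ⟨Normal.conj_mem inferInstance _ hx.1 g, hx.2.conj g⟩⟩

lemma coprime_card_of_PE [hp : Fact p.Prime] [Finite G] {H : Subgroup G} (h : ∀ x ∈ H, PE p x) :
    (Nat.card H).Coprime p := by
  rw [Nat.coprime_comm, Nat.Prime.coprime_iff_not_dvd hp.1]
  intro hd
  obtain ⟨x, hx⟩ := exists_prime_orderOf_dvd_card' p hd
  have := h x x.2
  rw [PE, Subgroup.orderOf_coe, hx, Nat.coprime_self] at this
  exact hp.1.ne_one this

/-- in a group all of whose p-regular elements are trivial, everything is a `p`-group -/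
lemma isPGroup_of_PE [hp : Fact p.Prime] [Finite G] {H : Subgroup G}
    (h : ∀ x ∈ H, PE p x → x = 1) : IsPGroup p H := by
  rintro ⟨x, hx⟩
  obtain ⟨a, ha⟩ := exists_pow_PE (p := p) x
  exact ⟨a, Subtype.ext (by simpa using h _ (pow_mem hx _) ha)⟩

/-- image of `H` is a `p`-group if `f` kills all p-regular elements of `H` -/
lemma isPGroup_map_of_PE [hp : Fact p.Prime] [Finite G] {H : Subgroup G} (f : G →* G')
    (h : ∀ x ∈ H, PE p x → f x = 1) : IsPGroup p (H.map f) := by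
  rintro ⟨_, x, hx, rfl⟩
  obtain ⟨a, ha⟩ := exists_pow_PE (p := p) x
  exact ⟨a, Subtype.ext (by simpa using h _ (pow_mem hx _) ha)⟩

lemma PN.of_isPNilpotent [hp : Fact p.Prime] [Finite G] {M : Subgroup G}
    (K : Subgroup M) (hK : K.Normal) (h : ∀ P : Sylow p M, IsComplement' K P) : PN p M := by
  obtain ⟨P⟩ : Nonempty (Sylow p M) := inferInstance
  have h1' := (h P).index_eq_card
  have h1 := (h P).symm.index_eq_card
  have hc : (Nat.card K).Coprime p := by
    rw [← h1', Nat.coprime_comm, Nat.Prime.coprime_iff_not_dvd hp.1]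
    exact P.not_dvd_index
  obtain ⟨n, hn⟩ := IsPGroup.iff_card.1 P.2
  have key : ∀ x : M, PE p x → x ∈ K := by
    intro x hx
    rw [← QuotientGroup.eq_one_iff]
    refine (hx.map (QuotientGroup.mk' K)).eq_one_of_pow (n := n) ?_
    rw [← hn, ← h1]
    exact pow_card_eq_one'
  apply PN.of_top
  intro x _ y _ hx hy
  exact PE.of_card hc (K.mul_mem (key x hx) (key y hy))

lemma PN.centralize [Fact p.Prime] {H M : Subgroup G} (hn : M ≤ normalizer (H : Set G)) (hH : IsPGroup p H)
    (hHM : H ≤ M) (hM : PN p M) {x h : G} (hx : x ∈ M) (hxp : PE p x) (hh : h ∈ H) :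
    x * h = h * x := by
  have h1 : x * (h * x⁻¹ * h⁻¹) ∈ H := by
    have := H.mul_mem ((mem_normalizer_iff.1 (hn hx) h).1 hh) (H.inv_mem hh)
    convert this using 1; group
  have h2 : PE p (x * (h * x⁻¹ * h⁻¹)) :=
    hM _ hx _ (M.mul_mem (M.mul_mem (hHM hh) (M.inv_mem hx)) (M.inv_mem (hHM hh))) hxp (hxp.inv.conj h)
  have h3 := h2.eq_one hH h1
  have : x * (h * x⁻¹ * h⁻¹) = (x * h) * (h * x)⁻¹ := by group
  rw [this] at h3
  exact mul_inv_eq_one.1 h3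

end basic

end Th
namespace Th

open Subgroup
open scoped commutatorElement

section frob

variable {p : ℕ} [hp : Fact p.Prime] {G : Type*} [Group G] [Finite G]

lemma PN.decomp (h : PN p (⊤ : Subgroup G)) (U : Sylow p G) (g : G) :
    ∃ k u, PE p k ∧ u ∈ U ∧ g = k * u := by
  have hn := h.core_normal
  have htop : h.core ⊔ (U : Subgroup G) = ⊤ := by
    rw [← Subgroup.index_eq_one]
    have hg : IsPGroup p (G ⧸ h.core) := by
      intro x
      obtain ⟨x, rfl⟩ := QuotientGroup.mk'_surjective _ x
      obtain ⟨a, ha⟩ := exists_pow_PE (p := p) x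
      refine ⟨a, ?_⟩
      rw [← _root_.map_pow]
      exact (QuotientGroup.eq_one_iff _).2 ⟨trivial, ha⟩
    obtain ⟨n, hn'⟩ := IsPGroup.iff_card.1 hg
    have h1 : (h.core ⊔ (U : Subgroup G)).index ∣ p ^ n := by
      rw [← hn']
      exact Subgroup.index_dvd_of_le le_sup_left
    have h2 : (h.core ⊔ (U : Subgroup G)).index ∣ (U : Subgroup G).index :=
      Subgroup.index_dvd_of_le le_sup_right
    refine Nat.Coprime.eq_one_of_dvd ?_ h1
    refine Nat.Coprime.coprime_dvd_left h2 ?_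
    exact Nat.Coprime.pow_right _ ((Nat.Prime.coprime_iff_not_dvd hp.1).2 U.not_dvd_index).symm
  have hg : g ∈ h.core ⊔ (U : Subgroup G) := by rw [htop]; trivial
  obtain ⟨k, hk, u, hu, rfl⟩ := Subgroup.mem_sup_of_normal_left.1 hg
  exact ⟨k, u, hk.2, hu, rfl⟩

lemma lt_inf_normalizer {D S : Subgroup G} (hS : IsPGroup p S) (h : D < S) :
    D < S ⊓ normalizer (D : Set G) := by
  have hnil : Group.IsNilpotent S := hS.isNilpotent
  have h1 : D.subgroupOf S < ⊤ := by
    rw [lt_top_iff_ne_top, Ne, subgroupOf_eq_top]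
    exact not_le_of_gt h
  have h2 := Group.normalizerCondition_of_isNilpotent (G := S) _ h1
  rw [← subgroupOf_normalizer_eq h.le] at h2
  refine lt_of_le_of_ne (le_inf h.le le_normalizer) ?_
  intro he
  apply h2.ne
  ext x
  simp only [mem_subgroupOf]
  constructor
  · intro hx; exact le_normalizer hx
  · intro hx; rw [he]; exact ⟨x.2, hx⟩

lemma sylow_conj (hF : ∀ X : Subgroup G, IsPGroup p X → X ≠ ⊥ → PN p (normalizer (X : Set G))) :
    ∀ n, ∀ S T : Sylow p G, Nat.card G - Nat.card (S ⊓ T : Subgroup G) = n →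
      ∃ c : G, (∀ d ∈ (S ⊓ T : Subgroup G), c * d = d * c) ∧ c • S = T := by
  intro n
  induction n using Nat.strong_induction_on with
  | _ n ih =>
  intro S T hn
  have ih' : ∀ S' T' : Sylow p G, (S ⊓ T : Subgroup G) < (S' ⊓ T' : Subgroup G) →
      ∃ c : G, (∀ d ∈ (S' ⊓ T' : Subgroup G), c * d = d * c) ∧ c • S' = T' := by
    intro S' T' hlt
    refine ih _ ?_ S' T' rfl
    have h1 : Nat.card (S ⊓ T : Subgroup G) < Nat.card (S' ⊓ T' : Subgroup G) :=
      Set.ncard_lt_ncard (s := ((S ⊓ T : Subgroup G) : Set G)) hlt (Set.toFinite _)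
    have h2 : Nat.card (S' ⊓ T' : Subgroup G) ≤ Nat.card G := Subgroup.card_le_card_group _
    omega
  set D : Subgroup G := S ⊓ T with hD
  by_cases hb : D = ⊥
  · obtain ⟨c, hc⟩ := MulAction.exists_smul_eq G S T
    refine ⟨c, ?_, hc⟩
    intro d hd
    rw [hb, Subgroup.mem_bot] at hd
    simp [hd]
  by_cases hST : S = T
  · exact ⟨1, by simp, by simp [hST]⟩
  have hDS : D < S := by
    refine lt_of_le_of_ne inf_le_left fun h => hST ?_
    have : (S : Subgroup G) ≤ T := h ▸ inf_le_right
    exact (Sylow.ext (S.3 T.2 this)).symm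
  have hDT : D < T := by
    refine lt_of_le_of_ne inf_le_right fun h => hST ?_
    have : (T : Subgroup G) ≤ S := h ▸ inf_le_left
    exact (Sylow.ext (T.3 S.2 this))
  have hDp : IsPGroup p D := S.2.to_le hDS.le
  set N := normalizer (D : Set G) with hN
  have hPN : PN p N := hF D hDp hb
  have hPN' : PN p (⊤ : Subgroup N) := by
    have := hPN.comap (f := N.subtype) N.subtype_injective
    exact this.mono (fun x _ => x.2)
  have hS1 := lt_inf_normalizer S.2 hDS
  have hT1 := lt_inf_normalizer T.2 hDT
  have hSp : IsPGroup p (((S : Subgroup G) ⊓ N).subgroupOf N) :=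
    (S.2.to_le inf_le_left).comap_subtype
  have hTp : IsPGroup p (((T : Subgroup G) ⊓ N).subgroupOf N) :=
    (T.2.to_le inf_le_left).comap_subtype
  obtain ⟨U, hU⟩ := hSp.exists_le_sylow
  obtain ⟨W, hW⟩ := hTp.exists_le_sylow
  obtain ⟨n, hnUW⟩ := MulAction.exists_smul_eq N U W
  obtain ⟨k, u, hk, hu, rfl⟩ := hPN'.decomp U n
  rw [mul_smul, Sylow.smul_eq_iff_mem_normalizer.2 (le_normalizer hu)] at hnUW
  obtain ⟨S1, hS1'⟩ := (U.2.map N.subtype).exists_le_sylow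
  have hle1 : (S : Subgroup G) ⊓ N ≤ S1 := fun x hx =>
    hS1' ⟨⟨x, hx.2⟩, hU (mem_subgroupOf.2 hx), rfl⟩
  have hle2 : (T : Subgroup G) ⊓ N ≤ ((k : G) • S1 : Sylow p G) := by
    intro x hx
    have hxW : (⟨x, hx.2⟩ : N) ∈ W := hW (mem_subgroupOf.2 hx)
    rw [← hnUW] at hxW
    obtain ⟨y, hy, hyx⟩ := hxW
    refine ⟨y, hS1' ⟨y, hy, rfl⟩, ?_⟩
    simpa using congrArg Subtype.val hyx
  obtain ⟨c1, hc1, hc1'⟩ := ih' S S1 (lt_of_lt_of_le hS1 (le_inf inf_le_left hle1))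
  obtain ⟨c2, hc2, hc2'⟩ := ih' ((k : G) • S1) T (lt_of_lt_of_le hT1 (le_inf hle2 inf_le_left))
  refine ⟨c2 * (k * c1), ?_, ?_⟩
  · intro d hd
    have e1 := hc1 d ⟨hd.1, hle1 (hS1.le hd)⟩
    have e2 := hc2 d ⟨hle2 (hT1.le hd), hd.2⟩
    have e3 := PN.centralize (le_refl _) hDp le_normalizer hPN k.2 hk.coe hd
    have c1 : Commute c1 d := e1
    have c2 : Commute c2 d := e2
    have c3 : Commute (k : G) d := e3
    exact c2.mul_left (c3.mul_left c1)
  · rw [mul_smul, mul_smul, hc1', hc2']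

/-- control of fusion -/
lemma fusion (hF : ∀ X : Subgroup G, IsPGroup p X → X ≠ ⊥ → PN p (normalizer (X : Set G)))
    (P : Sylow p G) (x g : G) (hx : x ∈ P) (hgx : g * x * g⁻¹ ∈ P) :
    ∃ w ∈ P, g * x * g⁻¹ = w * x * w⁻¹ := by
  by_cases hb : (P : Subgroup G) = ⊥
  · have : x ∈ (P : Subgroup G) := hx
    rw [hb, Subgroup.mem_bot] at this
    exact ⟨1, P.one_mem, by simp [this]⟩
  have hx2 : x ∈ (g⁻¹ • P : Sylow p G) := by
    refine ⟨_, hgx, ?_⟩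
    simp [mul_assoc]
  obtain ⟨c, hc, hc'⟩ := sylow_conj hF _ P (g⁻¹ • P) rfl
  have hcx := hc x ⟨hx, hx2⟩
  have hmem : g * c ∈ normalizer (P : Set G) := by
    rw [← Sylow.smul_eq_iff_mem_normalizer, mul_smul, hc', smul_inv_smul]
  have hPN := hF P P.2 hb
  set N := normalizer ((P : Subgroup G) : Set G) with hN
  have hPN' : PN p (⊤ : Subgroup N) := by
    have := hPN.comap (f := N.subtype) N.subtype_injective
    exact this.mono (fun x _ => x.2)
  obtain ⟨k, u, hk, hu, hku⟩ := hPN'.decomp (P.subtype le_normalizer) ⟨g * c, hmem⟩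
  have hku' : g * c = k * u := congrArg Subtype.val hku
  have huP : (u : G) ∈ (P : Subgroup G) := hu
  refine ⟨u, hu, ?_⟩
  have h1 : g * x * g⁻¹ = (g * c) * x * (g * c)⁻¹ := by
    rw [mul_assoc g c x, hcx]; group
  have h2 : (k : G) * (u * x * (u : G)⁻¹) = (u * x * (u : G)⁻¹) * k :=
    PN.centralize (H := (P : Subgroup G)) (le_refl _) P.2 le_normalizer hPN k.2 hk.coe
      (mul_mem (mul_mem huP hx) (inv_mem huP))
  rw [h1, hku', mul_inv_rev]
  calc (k : G) * u * x * ((u : G)⁻¹ * (k : G)⁻¹) = (k : G) * (u * x * (u : G)⁻¹) * (k : G)⁻¹ := by group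
    _ = _ := by rw [h2]; group

end frob

theorem frobenius {p : ℕ} [hp : Fact p.Prime] : ∀ n : ℕ, ∀ (G : Type*) [Group G] [Finite G],
    Nat.card G = n →
    (∀ X : Subgroup G, IsPGroup p X → X ≠ ⊥ → PN p (normalizer (X : Set G))) →
    PN p (⊤ : Subgroup G) := by
  intro n
  induction n using Nat.strong_induction_on with
  | _ n ih =>
  intro G _ _ hn hF
  obtain ⟨P⟩ : Nonempty (Sylow p G) := inferInstance
  by_cases hb : (P : Subgroup G) = ⊥
  · have hc : (Nat.card (⊤ : Subgroup G)).Coprime p := by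
      have := P.not_dvd_index
      rw [hb, Subgroup.index_bot] at this
      rw [Subgroup.card_top, Nat.coprime_comm]
      exact (Nat.Prime.coprime_iff_not_dvd hp.1).2 this
    intro x hx y hy _ _
    exact PE.of_card hc (mul_mem hx hy)
  have hfoc : (P : Subgroup G).focalSubgroup ≤ ⁅(P : Subgroup G), (P : Subgroup G)⁆ := by
    rw [focalSubgroup_def, closure_le]
    rintro g ⟨hg, x, hx, u, rfl⟩
    have hux : u * x⁻¹ * u⁻¹ ∈ P := by
      have : u * x⁻¹ * u⁻¹ = x⁻¹ * ⁅x, u⁆ := by rw [commutatorElement_def]; group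
      rw [this]
      exact mul_mem (inv_mem hx) hg
    obtain ⟨w, hw, e⟩ := fusion hF P x⁻¹ u (inv_mem hx) hux
    have : ⁅x, u⁆ = ⁅x, w⁆ := by
      rw [commutatorElement_def, commutatorElement_def, mul_assoc, mul_assoc, ← mul_assoc u, e]; group
    rw [this]
    exact commutator_mem_commutator hx hw
  set M := (P : Subgroup G).transferFocal.ker with hM
  have hPnil : Group.IsNilpotent P := P.2.isNilpotent
  have hMtop : M ≠ ⊤ := by
    intro h
    have h1 := ker_transferFocal_inf_eq_focalSubgroup P
    rw [← hM, h, top_inf_eq] at h1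
    have h2 : (P : Subgroup G) ≤ ⁅(P : Subgroup G), (P : Subgroup G)⁆ := h1.le.trans hfoc
    rw [← map_subtype_commutator] at h2
    have h3 : _root_.commutator P = ⊤ := by
      rw [eq_top_iff]
      rintro ⟨x, hx⟩ _
      obtain ⟨y, hy, e⟩ := h2 hx
      have : y = ⟨x, hx⟩ := Subtype.ext e
      exact this ▸ hy
    have hnt : Nontrivial P := (Subgroup.nontrivial_iff_ne_bot _).2 hb
    have := Group.IsSolvable.commutator_lt_top_of_nontrivial P
    exact this.ne h3
  have hlt : Nat.card M < n := by
    rw [← hn]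
    refine lt_of_le_of_ne (Subgroup.card_le_card_group _) fun h => hMtop ?_
    exact Subgroup.eq_top_of_card_eq _ h
  have hPM : PN p (⊤ : Subgroup M) := by
    refine ih _ hlt M rfl ?_
    intro X hX hXb
    have h1 := hF (X.map M.subtype) (hX.map _) (by
      rwa [Ne, Subgroup.map_eq_bot_iff_of_injective _ M.subtype_injective])
    refine (h1.comap (f := M.subtype) M.subtype_injective).mono ?_
    rw [← Subgroup.map_le_iff_le_comap]
    exact le_normalizer_map _
  have hmem : ∀ x : G, PE p x → x ∈ M := by
    intro x hx
    rw [hM, MonoidHom.mem_ker]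
    have := hx.map (P : Subgroup G).transferFocal
    have hQ : IsPGroup p (P ⧸ (P : Subgroup G).focalSubgroupOf) := P.2.to_quotient _
    obtain ⟨k, hk⟩ := hQ ((P : Subgroup G).transferFocal x)
    exact this.eq_one_of_pow hk
  intro x _ y _ hx hy
  exact hPM.of_top x (hmem x hx) y (hmem y hy) hx hy

end Th
namespace Th

open Subgroup

section quad

lemma quad {E : Type*} [Ring E] {p : ℕ} (hp : p.Prime) (hodd : Odd p) (hE : ∀ e : E, p • e = 0)
    {n r : E} {m : ℕ} (hm : m.Coprime p) (hn : n * n = 0) (hr : r ^ m = 1)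
    (h1 : r * ((1 + n) * r * (1 - n)) = ((1 + n) * r * (1 - n)) * r)
    (h2 : r * ((1 - n) * r * (1 + n)) = ((1 - n) * r * (1 + n)) * r) : r * n = n * r := by
  set d := r * n - n * r with hd
  have hdd : 2 • (r * d - d * r) = 0 := by
    have e : 2 • (r * d - d * r) = (r * ((1 - n) * r * (1 + n)) - ((1 - n) * r * (1 + n)) * r)
        - (r * ((1 + n) * r * (1 - n)) - ((1 + n) * r * (1 - n)) * r) := by
      rw [hd]; noncomm_ring
    rw [e, h1, h2]; simp
  have hc : r * d = d * r := by
    obtain ⟨k, hk⟩ := hodd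
    have h3 := hE (r * d - d * r)
    rw [hk, add_smul, mul_comm, mul_smul, hdd, smul_zero, zero_add, one_smul] at h3
    exact sub_eq_zero.1 h3
  have hpow : ∀ k : ℕ, r ^ (k + 1) * n = n * r ^ (k + 1) + (k + 1) • (r ^ k * d) := by
    intro k
    induction k with
    | zero => simp [hd]
    | succ k ih =>
      have hck : r ^ (k + 1) * d = d * r ^ (k + 1) := ((show Commute r d from hc).pow_left (k + 1)).eq
      calc r ^ (k + 1 + 1) * n = r * (r ^ (k + 1) * n) := by rw [pow_succ' r (k + 1), mul_assoc]
        _ = r * n * r ^ (k + 1) + (k + 1) • (r ^ (k + 1) * d) := by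
            rw [ih, mul_add, mul_smul_comm, ← mul_assoc, ← mul_assoc, ← pow_succ']
        _ = (n * r + d) * r ^ (k + 1) + (k + 1) • (r ^ (k + 1) * d) := by rw [hd]; simp
        _ = _ := by
            rw [add_mul, ← hck, mul_assoc, ← pow_succ', add_smul (k + 1) 1, one_smul]; abel
  have hm0 : m ≠ 0 := by
    rintro rfl
    rw [Nat.coprime_zero_left] at hm
    exact hp.ne_one hm
  obtain ⟨k, rfl⟩ := Nat.exists_eq_succ_of_ne_zero hm0
  have h3 := hpow k
  rw [Nat.succ_eq_add_one] at hr
  rw [hr, one_mul, mul_one] at h3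
  have h4 : (k + 1) • (r ^ k * d) = 0 := by simpa using h3.symm
  have h5 : (k + 1) • d = 0 := by
    have : (k + 1) • d = r * ((k + 1) • (r ^ k * d)) := by
      rw [mul_smul_comm, ← mul_assoc, ← pow_succ', hr, one_mul]
    rw [this, h4, mul_zero]
  have h6 : addOrderOf d ∣ 1 := by
    rw [← hm]
    exact Nat.dvd_gcd (addOrderOf_dvd_of_nsmul_eq_zero h5) (addOrderOf_dvd_of_nsmul_eq_zero (hE d))
  have h7 : d = 0 := AddMonoid.addOrderOf_eq_one_iff.1 (Nat.dvd_one.1 h6)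
  exact sub_eq_zero.1 (hd ▸ h7)

end quad

section norm

variable {R : Type*} [CommGroup R] {p : ℕ}

lemma norm_fixed (γ : MulAut R) (n : ℕ) (h : γ ^ n = 1) (q : R) :
    γ (∏ j ∈ Finset.range n, (γ ^ j) q) = ∏ j ∈ Finset.range n, (γ ^ j) q := by
  rw [_root_.map_prod]
  have e : ∀ j, γ ((γ ^ j) q) = (γ ^ (j + 1)) q := fun j => by rw [pow_succ', MulAut.mul_apply]
  simp_rw [e]
  have h1 := Finset.prod_range_succ (fun j => (γ ^ j) q) n
  have h2 := Finset.prod_range_succ' (fun j => (γ ^ j) q) n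
  rw [h1] at h2
  simp only [h, pow_zero] at h2
  exact (mul_right_cancel h2).symm

lemma norm_trick (hp : p.Prime) (α β : MulAut R) (hab : Commute α β) (ha : α ^ p = 1)
    (hb : β ^ p = 1) (C : Subgroup R) (hC : ∀ c ∈ C, α c ∈ C)
    (h1 : ∀ i : ℕ, ∀ q, (α * β ^ i) q = q → q ∈ C) (h2 : ∀ q, β q = q → q ∈ C) (q : R) :
    q ^ p ∈ C := by
  have hF : ∀ i : ℕ, ∏ j ∈ Finset.range p, ((α * β ^ i) ^ j) q ∈ C := by
    intro i
    refine h1 i _ (norm_fixed _ _ ?_ q)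
    rw [(hab.pow_right i).mul_pow, ha, one_mul, ← pow_mul, mul_comm, pow_mul, hb, one_pow]
  have hG := C.prod_mem (t := Finset.range p) (fun i _ => hF i)
  rw [Finset.prod_comm] at hG
  obtain ⟨m, rfl⟩ := Nat.exists_eq_succ_of_ne_zero hp.ne_zero
  rw [Finset.prod_range_succ'] at hG
  simp only [pow_zero, MulAut.one_apply, Finset.prod_const, Finset.card_range] at hG
  have hαC : ∀ j : ℕ, ∀ c ∈ C, (α ^ j) c ∈ C := by
    intro j
    induction j with
    | zero => simp
    | succ j ih => intro c hc; rw [pow_succ', MulAut.mul_apply]; exact hC _ (ih _ hc)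
  refine (C.mul_mem_cancel_left ?_).1 hG
  refine C.prod_mem fun j hj => ?_
  have e : ∀ i, ((α * β ^ i) ^ (j + 1)) q = (α ^ (j + 1)) (((β ^ (j + 1)) ^ i) q) := by
    intro i
    rw [(hab.pow_right i).mul_pow, MulAut.mul_apply, ← pow_mul, ← pow_mul, mul_comm]
  simp_rw [e]
  rw [← _root_.map_prod]
  apply hαC
  apply h2
  have hj' : (j + 1) < m + 1 := by simpa using hj
  have hco : Nat.Coprime (j + 1) (orderOf β) := by
    have : orderOf β ∣ m + 1 := orderOf_dvd_of_pow_eq_one hb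
    exact Nat.Coprime.coprime_dvd_right this ((Nat.coprime_of_lt_prime (by omega) hj' hp).symm)
  obtain ⟨k, hk⟩ := exists_pow_eq_self_of_coprime hco
  set w := ∏ i ∈ Finset.range m.succ, ((β ^ (j + 1)) ^ i) q with hw
  have hfix : (β ^ (j + 1)) w = w :=
    norm_fixed (β ^ (j + 1)) (m + 1) (by rw [← pow_mul, mul_comm, pow_mul, hb, one_pow]) q
  have hfk : ∀ k : ℕ, ((β ^ (j + 1)) ^ k) w = w := by
    intro k
    induction k with
    | zero => simp
    | succ k ih => rw [pow_succ, MulAut.mul_apply, hfix, ih]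
  rw [← hk]
  exact hfk k

end norm

section lin

variable {p : ℕ} [hp : Fact p.Prime] {V : Type*} [AddCommGroup V] [Finite V]
  {Γ : Type*} [Group Γ] (ρ : Γ →* AddMonoid.End V)

/-- fixed points -/
def fx (D : Subgroup Γ) : AddSubgroup V where
  carrier := {v | ∀ d ∈ D, ρ d v = v}
  zero_mem' := by simp
  add_mem' := fun ha hb d hd => by rw [_root_.map_add, ha d hd, hb d hd]
  neg_mem' := fun ha d hd => by rw [_root_.map_neg, ha d hd]

lemma mem_fx {D : Subgroup Γ} {v : V} : v ∈ fx ρ D ↔ ∀ d ∈ D, ρ d v = v := Iff.rfl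

lemma rho_mul (a b : Γ) (v : V) : ρ (a * b) v = ρ a (ρ b v) := by
  rw [_root_.map_mul]; rfl

lemma rho_one (v : V) : ρ 1 v = v := by rw [_root_.map_one]; rfl

lemma exists_fixed (hV : ∀ v : V, p • v = 0) {D : Subgroup Γ} (hD : IsPGroup p D)
    (W : AddSubgroup V) (hW : ∀ d ∈ D, ∀ w ∈ W, ρ d w ∈ W) (hne : W ≠ ⊥) :
    ∃ w ∈ W, w ≠ 0 ∧ ∀ d ∈ D, ρ d w = w := by
  letI : MulAction D W :=
    { smul := fun d w => ⟨ρ (d : Γ) (w : V), hW d d.2 w w.2⟩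
      one_smul := fun w => Subtype.ext (rho_one ρ _)
      mul_smul := fun a b w => Subtype.ext (rho_mul ρ _ _ _) }
  have hdvd : p ∣ Nat.card W := by
    obtain ⟨w, hw0⟩ := AddSubgroup.ne_bot_iff_exists_ne_zero.1 hne
    have : addOrderOf w = p := addOrderOf_eq_prime (Subtype.ext (by simpa using hV w)) hw0
    rw [← this]
    exact addOrderOf_dvd_natCard w
  have h0 : (0 : W) ∈ MulAction.fixedPoints D W := fun d => Subtype.ext (_root_.map_zero (ρ d))
  obtain ⟨b, hb, hb0⟩ := hD.exists_fixed_point_of_prime_dvd_card_of_fixed_point W hdvd h0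
  refine ⟨b, b.2, fun h => hb0 (Subtype.ext h.symm), fun d hd => ?_⟩
  exact congrArg Subtype.val (hb ⟨d, hd⟩)

/-- Thompson `A × B` lemma, for one p-regular element -/
lemma axb (hV : ∀ v : V, p • v = 0) {D : Subgroup Γ} (hD : IsPGroup p D) {r : Γ} (hr : PE p r)
    (hc : ∀ d ∈ D, d * r = r * d) (hf : ∀ v ∈ fx ρ D, ρ r v = v) (v : V) : ρ r v = v := by
  set m := orderOf r with hm
  let K : AddSubgroup V :=
    { carrier := {v | ∑ i ∈ Finset.range m, ρ (r ^ i) v = 0}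
      zero_mem' := by simp
      add_mem' := fun {a b} ha hb => by
        simp only [Set.mem_setOf_eq, _root_.map_add, Finset.sum_add_distrib] at ha hb ⊢
        rw [ha, hb, add_zero]
      neg_mem' := fun {a} ha => by
        simp only [Set.mem_setOf_eq, _root_.map_neg, Finset.sum_neg_distrib] at ha ⊢
        rw [ha, neg_zero] }
  have hK : ∀ v, v ∈ K ↔ ∑ i ∈ Finset.range m, ρ (r ^ i) v = 0 := fun v => Iff.rfl
  have hker : K = ⊥ := by
    by_contra hne
    obtain ⟨w, hw, hw0, hwD⟩ := exists_fixed ρ hV hD K (by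
      intro d hd w hw
      rw [hK] at hw ⊢
      have : ∀ i, ρ (r ^ i) (ρ d w) = ρ d (ρ (r ^ i) w) := by
        intro i
        rw [← rho_mul, ← rho_mul, ((show Commute d r from hc d hd).pow_right i).eq]
      simp_rw [this]
      rw [← _root_.map_sum, hw, _root_.map_zero]) hne
    have hrw := hf w hwD
    have hri : ∀ i, ρ (r ^ i) w = w := by
      intro i
      induction i with
      | zero => rw [pow_zero, rho_one]
      | succ i ih => rw [pow_succ, rho_mul, hrw, ih]
    rw [hK] at hw
    simp only [hri, Finset.sum_const, Finset.card_range] at hw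
    have h6 : addOrderOf w ∣ 1 := by
      rw [← (hr : m.Coprime p)]
      exact Nat.dvd_gcd (addOrderOf_dvd_of_nsmul_eq_zero hw) (addOrderOf_dvd_of_nsmul_eq_zero (hV w))
    exact hw0 (AddMonoid.addOrderOf_eq_one_iff.1 (Nat.dvd_one.1 h6))
  have hmem : ρ r v - v ∈ K := by
    rw [hK]
    simp only [_root_.map_sub, Finset.sum_sub_distrib]
    rw [sub_eq_zero]
    have e : ∀ i, ρ (r ^ i) (ρ r v) = ρ (r ^ (i + 1)) v := fun i => by rw [← rho_mul, pow_succ]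
    simp_rw [e]
    have h1 := Finset.sum_range_succ (fun j => ρ (r ^ j) v) m
    have h2 := Finset.sum_range_succ' (fun j => ρ (r ^ j) v) m
    rw [h1] at h2
    simp only [hm, pow_orderOf_eq_one, pow_zero] at h2
    exact (add_right_cancel h2).symm
  rw [hker, AddSubgroup.mem_bot, sub_eq_zero] at hmem
  exact hmem

/-- the action of the normalizer on the fixed points -/
def res (D : Subgroup Γ) : normalizer (D : Set Γ) →* AddMonoid.End (fx ρ D) where
  toFun g :=
    { toFun := fun v : fx ρ D => ⟨ρ (g : Γ) (v : V), fun d hd => by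
        have h : (g : Γ)⁻¹ * d * g ∈ D := (mem_normalizer_iff''.1 g.2 d).1 hd
        have e := v.2 _ h
        rw [← rho_mul]
        conv_rhs => rw [← e]
        rw [← rho_mul]
        congr 2
        group⟩
      map_zero' := Subtype.ext (_root_.map_zero (ρ g))
      map_add' := fun a b => Subtype.ext (_root_.map_add (ρ (g : Γ)) (a : V) (b : V)) }
  map_one' := by ext v; exact rho_one ρ _
  map_mul' a b := by ext v; exact rho_mul ρ _ _ _

lemma res_apply (D : Subgroup Γ) (g : normalizer (D : Set Γ)) (v : fx ρ D) :
    ((res ρ D g v : fx ρ D) : V) = ρ (g : Γ) (v : V) := rfl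

end lin

end Th
namespace Th

open Subgroup

section core

variable {p : ℕ} [hp : Fact p.Prime] {Γ : Type*} [Group Γ]

lemma core_i (R C : Subgroup Γ) (hRc : ∀ a ∈ R, ∀ b ∈ R, a * b = b * a) 
    {x y : Γ} (hx : x ∈ normalizer (R : Set Γ)) (hy : y ∈ normalizer (R : Set Γ))
    (hxp : x ^ p = 1) (hyp : y ^ p = 1) (hxy : y * x = x * y) (hyC : ∀ c ∈ C, y * c * y⁻¹ ∈ C)
    (h1 : ∀ i : ℕ, ∀ q ∈ R, y * x ^ i * q = q * (y * x ^ i) → q ∈ C)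
    (h2 : ∀ q ∈ R, x * q = q * x → q ∈ C) : ∀ q ∈ R, q ^ p ∈ C := by
  intro q hq
  let _ : CommGroup R :=
    { (inferInstance : Group R) with mul_comm := fun a b => Subtype.ext (hRc a a.2 b b.2) }
  let f : normalizer (R : Set Γ) →* MulAut R := R.normalizerMonoidHom
  have hf : ∀ (g : normalizer (R : Set Γ)) (r : R), ((f g r : R) : Γ) = g * r * (g : Γ)⁻¹ := fun g r => rfl
  let x' : normalizer (R : Set Γ) := ⟨x, hx⟩
  let y' : normalizer (R : Set Γ) := ⟨y, hy⟩
  have := norm_trick (R := R) hp.1 (f y') (f x') 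
    (Commute.map (show Commute y' x' from Subtype.ext hxy) f)
    (by rw [← _root_.map_pow, (Subtype.ext hyp : y' ^ p = 1), _root_.map_one]) 
    (by rw [← _root_.map_pow, (Subtype.ext hxp : x' ^ p = 1), _root_.map_one]) (C.subgroupOf R) 
    (by
      intro c hc
      rw [mem_subgroupOf] at hc ⊢
      rw [hf]; exact hyC _ hc)
    (by
      intro i q hq
      rw [mem_subgroupOf]
      refine h1 i q q.2 ?_
      rw [← _root_.map_pow, ← _root_.map_mul] at hq
      have := congrArg Subtype.val hq
      rw [hf] at this
      exact mul_inv_eq_iff_eq_mul.1 this)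
    (by
      intro q hq
      rw [mem_subgroupOf]
      refine h2 q q.2 ?_
      have := congrArg Subtype.val hq
      rw [hf] at this
      exact mul_inv_eq_iff_eq_mul.1 this) ⟨q, hq⟩
  exact this


variable {V : Type*} [AddCommGroup V] [Finite V] (ρ : Γ →* AddMonoid.End V)

lemma core_sq (hV : ∀ v : V, p • v = 0) {B D : Subgroup Γ} {x : Γ} (hxp : x ^ p = 1)
    (hxD : ∀ d ∈ D, d * x = x * d) (hBD : fx ρ B ≤ fx ρ D)
    (hB : ∀ v ∈ fx ρ D, ρ x v = v → v ∈ fx ρ B) (hBx : ∀ v ∈ fx ρ B, ρ x v = v)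
    (hcard : Nat.card (fx ρ D) ≤ p * Nat.card (fx ρ B)) :
    ∀ v ∈ fx ρ D, ρ x (ρ x v - v) = ρ x v - v := by
  let n : fx ρ D →+ V :=
    { toFun := fun v => ρ x (v : V) - v
      map_zero' := by simp
      map_add' := fun a b => by
        simp only [AddSubgroup.coe_add, _root_.map_add]; abel }
  have hn : ∀ v : fx ρ D, n v = ρ x (v : V) - v := fun v => rfl
  have hker : Nat.card n.ker = Nat.card (fx ρ B) := by
    refine Nat.card_congr ⟨fun v => ⟨v.1.1, hB _ v.1.2 (sub_eq_zero.1 v.2)⟩,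
      fun v => ⟨⟨v.1, hBD v.2⟩, sub_eq_zero.2 (hBx _ v.2)⟩, fun v => rfl, fun v => rfl⟩
  have h1 : Nat.card n.ker * Nat.card n.range = Nat.card (fx ρ D) := by
    rw [← AddSubgroup.index_ker, AddSubgroup.card_mul_index]
  have hpos : 0 < Nat.card (fx ρ B) := Nat.card_pos
  have hI : Nat.card n.range ≤ p := by
    rw [hker] at h1
    rw [← h1, mul_comm] at hcard
    exact Nat.le_of_mul_le_mul_right hcard hpos
  by_cases hbot : n.range = ⊥
  · intro v hv
    have : n ⟨v, hv⟩ ∈ n.range := ⟨_, rfl⟩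
    rw [hbot, AddSubgroup.mem_bot, hn] at this
    simp only at this
    rw [this, _root_.map_zero]
  have hDx : ∀ v ∈ fx ρ D, ρ x v ∈ fx ρ D := by
    intro v hv d hd
    rw [← rho_mul, hxD d hd, rho_mul, hv d hd]
  have hzx : IsPGroup p (zpowers x) := by
    rintro ⟨y, hy⟩
    obtain ⟨k, rfl⟩ := hy
    refine ⟨1, Subtype.ext ?_⟩
    show (x ^ k) ^ p ^ 1 = 1
    rw [pow_one, ← zpow_natCast, ← zpow_mul, mul_comm, zpow_mul, zpow_natCast, hxp, one_zpow]
  obtain ⟨w, hw, hw0, hwx⟩ := exists_fixed ρ hV hzx n.range (by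
    rintro d hd _ ⟨v, rfl⟩
    have hdD : ∀ v ∈ fx ρ D, ρ d v ∈ fx ρ D := by
      intro v hv e he
      have : Commute e d := by
        obtain ⟨k, rfl⟩ := hd
        exact (show Commute e x from hxD e he).zpow_right k
      rw [← rho_mul, this.eq, rho_mul, hv e he]
    refine ⟨⟨ρ d v, hdD _ v.2⟩, ?_⟩
    have : Commute x d := by
      obtain ⟨k, rfl⟩ := hd
      exact (Commute.refl x).zpow_right k
    simp only [hn, _root_.map_sub]
    rw [← rho_mul, ← rho_mul, this.eq]) hbot
  have hle : AddSubgroup.zmultiples w ≤ n.range := by rwa [AddSubgroup.zmultiples_le]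
  have heq : AddSubgroup.zmultiples w = n.range := by
    refine AddSubgroup.eq_of_le_of_card_ge hle ?_
    rw [Nat.card_zmultiples, addOrderOf_eq_prime (hV w) hw0]
    exact hI
  intro v hv
  have : n ⟨v, hv⟩ ∈ n.range := ⟨_, rfl⟩
  rw [← heq] at this
  obtain ⟨k, hk⟩ := this
  change k • w = ρ x v - v at hk
  rw [← hk, _root_.map_zsmul, hwx x (mem_zpowers x)]

lemma core_comm (hodd : Odd p) (hV : ∀ v : V, p • v = 0) {D : Subgroup Γ} {x r : Γ}
    (hr : PE p r)
    (hxD : ∀ d ∈ D, d * x = x * d) (hrD : ∀ d ∈ D, d * r = r * d)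
    (hsq : ∀ v ∈ fx ρ D, ρ x (ρ x v - v) = ρ x v - v)
    (h1 : r * (x * r * x⁻¹) = (x * r * x⁻¹) * r) (h2 : r * (x⁻¹ * r * x) = (x⁻¹ * r * x) * r) :
    ∀ v ∈ fx ρ D, ρ (r * x) v = ρ (x * r) v := by
  have hcent : ∀ y : Γ, (∀ d ∈ D, d * y = y * d) → y ∈ normalizer (D : Set Γ) := by
    intro y hy
    exact centralizer_le_normalizer _ (mem_centralizer_iff.2 hy)
  let x' : normalizer (D : Set Γ) := ⟨x, hcent x hxD⟩
  let r' : normalizer (D : Set Γ) := ⟨r, hcent r hrD⟩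
  have hE : ∀ e : AddMonoid.End (fx ρ D), p • e = 0 := by
    intro e
    refine AddMonoidHom.ext fun v => ?_
    have : p • e v = 0 := Subtype.ext (by simpa using hV _)
    exact this
  set X := res ρ D x' with hX
  set n : AddMonoid.End (fx ρ D) := X - 1 with hn
  have e1 : 1 + n = X := by rw [hn]; abel
  have hnn : n * n = 0 := by
    refine AddMonoidHom.ext fun v => Subtype.ext ?_
    have := hsq v v.2
    have h3 := sub_eq_zero.2 this
    exact h3
  have e2 : 1 - n = res ρ D x'⁻¹ := by
    have h3 : X * (1 - n) = 1 := by
      rw [← e1]; 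
      have : (1 + n) * (1 - n) = 1 - n * n := by
        rw [mul_sub, mul_one, add_mul, one_mul]; abel
      rw [this, hnn, sub_zero]
    have h4 : res ρ D x'⁻¹ * X = 1 := by rw [hX, ← _root_.map_mul, inv_mul_cancel, _root_.map_one]
    exact (left_inv_eq_right_inv h4 h3).symm
  have h := quad hp.1 hodd hE (n := n) (r := res ρ D r') hr hnn
    (by rw [← _root_.map_pow, (Subtype.ext (pow_orderOf_eq_one r) : r' ^ (orderOf r) = 1), _root_.map_one])
    (by
      rw [e1, e2, hX, ← _root_.map_mul, ← _root_.map_mul, ← _root_.map_mul, ← _root_.map_mul]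
      exact congrArg _ (Subtype.ext h1))
    (by
      rw [e1, e2, hX, ← _root_.map_mul, ← _root_.map_mul, ← _root_.map_mul, ← _root_.map_mul]
      exact congrArg _ (Subtype.ext h2))
  have h' : res ρ D r' * X = X * res ρ D r' := by
    rw [← e1, mul_add, add_mul, h]; simp
  intro v hv
  rw [hX, ← _root_.map_mul, ← _root_.map_mul] at h'
  have := congrArg (fun f : AddMonoid.End (fx ρ D) => ((f ⟨v, hv⟩ : fx ρ D) : V)) h'
  exact this

end core

end Th
namespace Th

open Subgroup

section core

variable {p : ℕ} [hp : Fact p.Prime] {Γ : Type*} [Group Γ] [Finite Γ]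
variable {V : Type*} [AddCommGroup V] [Finite V] (ρ : Γ →* AddMonoid.End V)

lemma PE.mem_of_pow {C : Subgroup Γ} {q : Γ} (hq : PE p q) (h : q ^ p ∈ C) : q ∈ C := by
  obtain ⟨k, hk⟩ := exists_pow_eq_self_of_coprime (n := p) (x := q) (Nat.Coprime.symm hq)
  rw [← hk]
  exact pow_mem h k

/-- centralizer of `D` in `Q` -/
def ct (Q D : Subgroup Γ) : Subgroup Γ := Q ⊓ centralizer (D : Set Γ)

lemma mem_ct {Q D : Subgroup Γ} {q : Γ} : q ∈ ct Q D ↔ q ∈ Q ∧ ∀ d ∈ D, d * q = q * d := by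
  rw [ct, mem_inf, mem_centralizer_iff]; rfl

lemma ct_sup {Q D : Subgroup Γ} {q x : Γ} (h : q ∈ ct Q D) (hx : x * q = q * x) :
    q ∈ ct Q (D ⊔ zpowers x) := by
  rw [ct, mem_inf, ← zpowers_le (H := centralizer _), le_centralizer_iff, sup_le_iff, zpowers_le]
  refine ⟨(mem_ct.1 h).1, ?_, ?_⟩
  · rw [← le_centralizer_iff, zpowers_le]
    exact h.2
  · rw [mem_centralizer_iff]
    rintro _ ⟨k, rfl⟩
    exact ((show Commute x q from hx).zpow_right k).eq.symm

theorem core_lemma (hodd : Odd p) (hV : ∀ v : V, p • v = 0) (hρ : Function.Injective ρ)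
    (Q : Subgroup Γ) (hQc : ∀ a ∈ Q, ∀ b ∈ Q, a * b = b * a) (hQp : ∀ a ∈ Q, PE p a) :
    ∀ n, ∀ B : Subgroup Γ, Nat.card B = n → (∀ a ∈ B, ∀ b ∈ B, a * b = b * a) →
      (∀ a ∈ B, a ^ p = 1) → B ≤ normalizer (Q : Set Γ) →
      (∀ b ∈ B, (∀ q ∈ Q, b * q = q * b) → b = 1) → B ≠ ⊥ →
      Nat.card B * Nat.card (fx ρ B) < Nat.card V := by
  intro n
  induction n using Nat.strong_induction_on with
  | _ n ih =>
  intro B hBn hBc hBp hBQ hBf hB0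
  by_contra hcon
  rw [not_lt] at hcon
  have hQB : ¬ ct Q ⊥ ≤ ct Q B := by
    intro h
    apply hB0
    rw [eq_bot_iff]
    intro b hb
    rw [mem_bot]
    refine hBf b hb fun q hq => ?_
    refine (mem_ct.1 (h (mem_ct.2 ⟨hq, ?_⟩))).2 b hb
    intro d hd
    rw [mem_bot] at hd
    simp [hd]
  obtain ⟨D, -, ⟨hDB, hD⟩, hDmax⟩ := Finite.exists_le_maximal (α := Subgroup Γ) (p := fun D => D ≤ B ∧ ¬ ct Q D ≤ ct Q B) (a := ⊥) 
    ⟨bot_le, hQB⟩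
  have hDne : D ≠ B := by rintro rfl; exact hD le_rfl
  have hDlt : D < B := lt_of_le_of_ne hDB hDne
  obtain ⟨x, hxB, hxD⟩ := SetLike.exists_of_lt hDlt
  have hmax : ∀ b ∈ B, b ∉ D → ∀ q ∈ ct Q D, b * q = q * b → q ∈ ct Q B := by
    intro b hb hbD q hq hbq
    by_contra hcc
    have h1 : D ⊔ zpowers b ≤ B ∧ ¬ ct Q (D ⊔ zpowers b) ≤ ct Q B :=
      ⟨sup_le hDB (by rwa [zpowers_le]), fun h => hcc (h (ct_sup hq hbq))⟩
    exact hbD (hDmax h1 le_sup_left (le_sup_right (a := D) (mem_zpowers b)))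
  have hnct : ∀ b ∈ B, ∀ D ≤ B, ∀ q ∈ ct Q D, b * q * b⁻¹ ∈ ct Q D := by
    intro b hb D hDB q hq
    rw [mem_ct] at hq ⊢
    refine ⟨(mem_normalizer_iff.1 (hBQ hb) q).1 hq.1, fun d hd => ?_⟩
    have h1 : Commute d b := hBc d (hDB hd) b hb
    have h2 : Commute d q := hq.2 d hd
    exact (h1.mul_right h2).mul_right h1.inv_right
  have hN : ∀ b ∈ B, b ∈ normalizer (ct Q D : Set Γ) := by
    intro b hb
    rw [mem_normalizer_iff]
    intro q
    refine ⟨hnct b hb D hDB q, fun h => ?_⟩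
    have := hnct b⁻¹ (B.inv_mem hb) D hDB _ h
    convert this using 1
    group
  by_cases hcase : D ⊔ zpowers x = B
  · -- cyclic case
    apply hD
    have hcardB : Nat.card B ≤ p * Nat.card D := by
      rw [← hcase]
      have hn : D ≤ normalizer (zpowers x : Set Γ) := by
        intro d hd
        refine centralizer_le_normalizer _ (mem_centralizer_iff.2 ?_)
        rintro _ ⟨k, rfl⟩
        exact ((show Commute d x from hBc d (hDB hd) x hxB).zpow_right k).eq.symm
      have h1 := coe_mul_of_left_le_normalizer_right D (zpowers x) hn
      have h2 : Nat.card (D ⊔ zpowers x : Subgroup Γ) ≤ Nat.card D * Nat.card (zpowers x) := by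
        have h3 := Set.natCard_mul_le (s := (D : Set Γ)) (t := (zpowers x : Set Γ))
        rw [← h1] at h3
        exact h3
      refine h2.trans ?_
      rw [mul_comm]
      refine Nat.mul_le_mul_right _ ?_
      rw [Nat.card_zpowers]
      exact orderOf_le_of_pow_eq_one hp.1.pos (hBp x hxB)
    have hcardD : Nat.card D * Nat.card (fx ρ D) ≤ Nat.card V := by
      by_cases hb : D = ⊥
      · rw [hb, card_bot, one_mul]
        exact Nat.card_le_card_of_injective _ (fx ρ ⊥).subtype_injective
      · refine (ih (Nat.card D) ?_ D rfl ?_ ?_ ?_ ?_ hb).le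
        · rw [← hBn]
          exact Set.Finite.card_lt_card (Set.toFinite _) hDlt
        · exact fun a ha b hb => hBc a (hDB ha) b (hDB hb)
        · exact fun a ha => hBp a (hDB ha)
        · exact hDB.trans hBQ
        · exact fun b hb => hBf b (hDB hb)
    have hcard : Nat.card (fx ρ D) ≤ p * Nat.card (fx ρ B) := by
      have h1 : Nat.card D * Nat.card (fx ρ D) ≤ Nat.card D * (p * Nat.card (fx ρ B)) := by
        calc _ ≤ Nat.card V := hcardD
          _ ≤ Nat.card B * Nat.card (fx ρ B) := hcon
          _ ≤ (p * Nat.card D) * Nat.card (fx ρ B) := Nat.mul_le_mul_right _ hcardB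
          _ = _ := by ring
      exact Nat.le_of_mul_le_mul_left h1 Nat.card_pos
    have hxc : ∀ d ∈ D, d * x = x * d := fun d hd => hBc d (hDB hd) x hxB
    have hsq := core_sq ρ hV (B := B) (D := D) (x := x) (hBp x hxB) hxc
      (fun v hv d hd => hv d (hDB hd)) (by
        intro v hv hxv
        let S : Subgroup Γ :=
          { carrier := {g | ρ g v = v}
            one_mem' := rho_one ρ v
            mul_mem' := fun {a b} ha hb => by
              show ρ (a * b) v = v
              rw [rho_mul, (show ρ b v = v from hb), (show ρ a v = v from ha)]
            inv_mem' := fun {a} ha => by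
              show ρ a⁻¹ v = v
              conv_lhs => rw [← (show ρ a v = v from ha)]
              rw [← rho_mul, inv_mul_cancel, rho_one] }
        have : B ≤ S := by
          rw [← hcase, sup_le_iff, zpowers_le]
          exact ⟨hv, hxv⟩
        exact this)
      (fun v hv => hv x hxB) hcard
    intro r hr
    rw [mem_ct] at hr ⊢
    refine ⟨hr.1, ?_⟩
    have hQx : ∀ b ∈ B, ∀ q ∈ Q, b * q * b⁻¹ ∈ Q := fun b hb q hq => (mem_normalizer_iff.1 (hBQ hb) q).1 hq
    have hQx' : x⁻¹ * r * x ∈ Q := by simpa using hQx x⁻¹ (B.inv_mem hxB) r hr.1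
    have hcc := core_comm ρ hodd hV (hQp r hr.1) hxc hr.2 hsq
      (hQc _ hr.1 _ (hQx x hxB r hr.1))
      (hQc _ hr.1 _ hQx')
    have hc1 : x⁻¹ * r⁻¹ * x * r ∈ Q := by
      refine Q.mul_mem ?_ hr.1
      have := Q.inv_mem hQx'
      convert this using 1; group
    have hxr : x⁻¹ * r⁻¹ * x * r = 1 := by
      apply hρ
      refine AddMonoidHom.ext fun v => ?_
      rw [_root_.map_one]
      refine axb ρ hV (D := D) ?_ (hQp _ hc1) ?_ ?_ v
      · rintro ⟨d, hd⟩
        exact ⟨1, Subtype.ext (by simpa using hBp d (hDB hd))⟩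
      · intro d hd
        have h1 : Commute d x := hxc d hd
        have h2 : Commute d r := hr.2 d hd
        exact ((h1.inv_right.mul_right h2.inv_right).mul_right h1).mul_right h2
      · intro v hv
        have : x⁻¹ * r⁻¹ * x * r = (r * x)⁻¹ * (x * r) := by group
        rw [this, rho_mul, ← hcc v hv, ← rho_mul, inv_mul_cancel, rho_one]
    have hxr' : x * r = r * x := by
      have : x⁻¹ * r⁻¹ * x * r = (r * x)⁻¹ * (x * r) := by group
      rw [this, inv_mul_eq_one] at hxr
      exact hxr.symm
    have := ct_sup (mem_ct.2 hr) hxr'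
    rw [hcase] at this
    exact (mem_ct.1 this).2
  · have hlt : D ⊔ zpowers x < B := lt_of_le_of_ne (sup_le hDB (by rwa [zpowers_le])) hcase
    obtain ⟨y, hyB, hyD⟩ := SetLike.exists_of_lt hlt
    apply hD
    intro q hq
    refine PE.mem_of_pow (hQp q hq.1) ?_
    refine core_i (ct Q D) (ct Q B) (fun a ha b hb => hQc a ha.1 b hb.1) (hN x hxB) (hN y hyB)
      (hBp x hxB) (hBp y hyB) (hBc y hyB x hxB) (hnct y hyB B le_rfl) ?_ (hmax x hxB hxD) q hq
    intro i
    refine hmax _ (B.mul_mem hyB (pow_mem hxB i)) ?_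
    intro h
    apply hyD
    have : y = (y * x ^ i) * (x ^ i)⁻¹ := by group
    rw [this]
    exact mul_mem (mem_sup_left h) (mem_sup_right (inv_mem (pow_mem (mem_zpowers x) i)))

end core

end Th
namespace Th

open Subgroup

section char

variable {p : ℕ} {G : Type*} [Group G]

/-- `C` is invariant under all automorphisms of `P` -/
def CharIn (C P : Subgroup G) : Prop := ∀ f : P ≃* P, ∀ x : P, (x : G) ∈ C → (f x : G) ∈ C

lemma CharIn.normalizer_le {C P : Subgroup G} (h : CharIn C P) (hCP : C ≤ P) :
    normalizer (P : Set G) ≤ normalizer (C : Set G) := by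
  have key : ∀ g ∈ normalizer (P : Set G), ∀ c ∈ C, g * c * g⁻¹ ∈ C := by
    intro g hg c hc
    exact h (P.normalizerMonoidHom ⟨g, hg⟩) ⟨c, hCP hc⟩ hc
  intro g hg
  rw [mem_normalizer_iff]
  refine fun c => ⟨key g hg c, fun hc => ?_⟩
  have := key g⁻¹ (inv_mem hg) _ hc
  convert this using 1
  group

lemma CharIn.map {G' : Type*} [Group G'] {C P : Subgroup G} (h : CharIn C P) (hCP : C ≤ P)
    (φ : G →* G') (hφ : Function.Injective φ) : CharIn (C.map φ) (P.map φ) := by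
  rintro f ⟨_, x, hx, rfl⟩ hxC
  obtain ⟨c, hc, hcx⟩ := hxC
  obtain rfl : c = x := hφ hcx
  let e := P.equivMapOfInjective φ hφ
  have h1 := h ((e.trans f).trans e.symm) ⟨c, hx⟩ hc
  refine ⟨_, h1, ?_⟩
  have h2 : ∀ y, φ (e.symm y : P) = (y : G') := by
    intro y
    rw [← coe_equivMapOfInjective_apply P φ hφ, MulEquiv.apply_symm_apply]
  exact h2 _

/-- hypothesis of the Thompson theorem -/
def Hyp (p : ℕ) (G : Type*) [Group G] : Prop :=
  ∀ P : Sylow p G, ∀ C : Subgroup G, C ≤ P → C ≠ ⊥ → CharIn C P → PN p (normalizer (C : Set G))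

variable [hp : Fact p.Prime] [Finite G]

lemma exists_sylow_le {M : Subgroup G} (h : ¬ p ∣ M.index) : ∃ P : Sylow p G, (P : Subgroup G) ≤ M := by
  obtain ⟨S⟩ : Nonempty (Sylow p M) := inferInstance
  have h1 : ¬ p ∣ ((S : Subgroup M).map M.subtype).index := by
    rw [index_map_subtype, hp.1.dvd_mul]
    rintro (h' | h')
    · exact S.not_dvd_index h'
    · exact h h'
  exact ⟨(S.2.map M.subtype).toSylow h1, map_subtype_le _⟩

lemma not_dvd_index_of_sylow_le {M : Subgroup G} (P : Sylow p G) (h : (P : Subgroup G) ≤ M) :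
    ¬ p ∣ M.index := by
  intro h'
  refine P.not_dvd_index (h'.trans ?_)
  rw [← relIndex_mul_index h]
  exact dvd_mul_left _ _

end char

section steps

universe u

variable {p : ℕ} [hp : Fact p.Prime] {G : Type u} [Group G] [Finite G]

/-- induction hypothesis for the Thompson theorem -/
def IHyp (p : ℕ) (G : Type u) : Prop := ∀ (K : Type u) [Group K] [Finite K],
  Nat.card K < Nat.card G → Hyp p K → PN p (⊤ : Subgroup K)

lemma tsub (ih : IHyp p G) {M : Subgroup G} (hM : M ≠ ⊤)
    (h : ∀ S : Sylow p M, ∀ C : Subgroup G, C ≤ (S : Subgroup M).map M.subtype → C ≠ ⊥ →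
      CharIn C ((S : Subgroup M).map M.subtype) → PN p (normalizer (C : Set G))) : PN p M := by
  apply PN.of_top
  apply ih
  · have : M < ⊤ := lt_top_iff_ne_top.2 hM
    have h2 : Nat.card M < Nat.card (⊤ : Subgroup G) :=
      Set.Finite.card_lt_card (Set.toFinite _) this
    rwa [card_top] at h2
  · intro S C hCS hC0 hC
    have h1 := h S (C.map M.subtype) (map_mono hCS) (by
      rw [Ne, map_eq_bot_iff_of_injective _ M.subtype_injective]; exact hC0)
      (hC.map hCS _ M.subtype_injective)
    refine (h1.comap M.subtype_injective).mono ?_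
    rw [← map_le_iff_le_comap]
    exact le_normalizer_map _

lemma step_a (ih : IHyp p G) (hG : Hyp p G) {M : Subgroup G} (hM : M ≠ ⊤) (P : Sylow p G)
    (hPM : (P : Subgroup G) ≤ M) : PN p M := by
  refine tsub ih hM fun S C hCS hC0 hC => ?_
  have h1 : ¬ p ∣ ((S : Subgroup M).map M.subtype).index := by
    rw [index_map_subtype, hp.1.dvd_mul]
    rintro (h' | h')
    · exact S.not_dvd_index h'
    · exact not_dvd_index_of_sylow_le P hPM h'
  exact hG ((S.2.map M.subtype).toSylow h1) C hCS hC0 hC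

lemma step_b (ih : IHyp p G) (hG : Hyp p G) (hn : ¬ PN p (⊤ : Subgroup G)) :
    ∃ X : Subgroup G, X.Normal ∧ IsPGroup p X ∧ X ≠ ⊥ := by
  have hne : {X : Subgroup G | IsPGroup p X ∧ X ≠ ⊥ ∧ ¬ PN p (normalizer (X : Set G))}.Nonempty := by
    by_contra hemp
    rw [Set.not_nonempty_iff_eq_empty, Set.eq_empty_iff_forall_notMem] at hemp
    apply hn
    refine frobenius _ G rfl fun X hX hX0 => ?_
    by_contra hc
    exact hemp X ⟨hX, hX0, hc⟩
  obtain ⟨X, ⟨hXp, hX0, hXn⟩, hmax⟩ := Set.exists_max_image _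
    (fun X : Subgroup G => (Nat.card (normalizer (X : Set G))).factorization p) (Set.toFinite _) hne
  refine ⟨X, ?_, hXp, hX0⟩
  rw [← normalizer_eq_top_iff]
  by_contra hM
  apply hXn
  refine tsub ih hM fun S C hCS hC0 hC => ?_
  set S' := (S : Subgroup (normalizer (X : Set G))).map (normalizer (X : Set G)).subtype with hS'
  have hS'p : IsPGroup p S' := S.2.map _
  by_cases hidx : p ∣ S'.index
  · obtain ⟨P', hP'⟩ := hS'p.exists_le_sylow
    have hlt : S' < P' := by
      refine lt_of_le_of_ne hP' ?_
      intro h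
      rw [h] at hidx
      exact P'.not_dvd_index hidx
    have hlt2 := lt_inf_normalizer P'.2 hlt
    by_contra hcon
    have h1 := hmax C ⟨hS'p.to_le hCS, hC0, hcon⟩
    obtain ⟨k, hk⟩ := IsPGroup.iff_card.1 (P'.2.to_le (inf_le_left (a := (P' : Subgroup G)) (b := normalizer (S' : Set G))))
    have h2 : p ^ k ∣ Nat.card (normalizer (C : Set G)) := by
      rw [← hk]
      exact card_dvd_of_le (inf_le_right.trans (hC.normalizer_le hCS))
    rw [hp.1.pow_dvd_iff_le_factorization Nat.card_pos.ne'] at h2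
    have h3 : Nat.card S' = p ^ (Nat.card (normalizer (X : Set G))).factorization p := by
      rw [← S.card_eq_multiplicity, hS']
      exact card_map_of_injective (subtype_injective _)
    have h4 : Nat.card S' < p ^ k := by
      rw [← hk]
      exact Set.Finite.card_lt_card (Set.toFinite _) hlt2
    rw [h3] at h4
    have h5 := (Nat.pow_lt_pow_iff_right hp.1.one_lt).1 h4
    omega
  · exact hG (hS'p.toSylow hidx) C hCS hC0 hC

/-- the largest normal `p`-subgroup -/
lemma step_H (X : Subgroup G) (hX : X.Normal) (hXp : IsPGroup p X) (hX0 : X ≠ ⊥) :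
    ∃ H : Subgroup G, H.Normal ∧ IsPGroup p H ∧ H ≠ ⊥ ∧
      ∀ K : Subgroup G, K.Normal → IsPGroup p K → K ≤ H := by
  obtain ⟨H, hXH, ⟨hH, hHp⟩, hmax⟩ := Finite.exists_le_maximal (α := Subgroup G)
    (p := fun K => K.Normal ∧ IsPGroup p K) (a := X) ⟨hX, hXp⟩
  refine ⟨H, hH, hHp, ?_, fun K hK hKp => ?_⟩
  · rintro rfl
    exact hX0 (le_bot_iff.1 hXH)
  · have h1 : (K ⊔ H).Normal := sup_normal K H
    have h2 : IsPGroup p (K ⊔ H : Subgroup G) := hKp.to_sup_of_normal_right hHp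
    exact le_sup_left.trans (hmax ⟨h1, h2⟩ le_sup_right)

lemma step_quot (ih : IHyp p G) (hG : Hyp p G) {H : Subgroup G} [hH : H.Normal] (hHp : IsPGroup p H)
    (hH0 : H ≠ ⊥) (hmax : ∀ K : Subgroup G, K.Normal → IsPGroup p K → K ≤ H) :
    PN p (⊤ : Subgroup (G ⧸ H)) := by
  have hsurj := QuotientGroup.mk'_surjective H
  have hker : IsPGroup p (QuotientGroup.mk' H).ker := by rwa [QuotientGroup.ker_mk']
  apply ih
  · have h1 := card_eq_card_quotient_mul_card_subgroup H
    have h2 : 1 < Nat.card H := (one_lt_card_iff_ne_bot H).2 hH0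
    have h3 : 0 < Nat.card (G ⧸ H) := Nat.card_pos
    rw [h1]
    nlinarith
  · intro P C hCP hC0 hC
    have hPr : (P : Subgroup (G ⧸ H)) ≤ (QuotientGroup.mk' H).range := by
      rw [MonoidHom.range_eq_top.2 hsurj]; exact le_top
    have h1 : (C.comap (QuotientGroup.mk' H)) ≤ (P.comapOfKerIsPGroup _ hker hPr : Sylow p G) :=
      comap_mono hCP
    have hCp : IsPGroup p (C.comap (QuotientGroup.mk' H)) :=
      (P.2.to_le hCP).comap_of_ker_isPGroup _ hker
    have h2 : PN p (normalizer (C.comap (QuotientGroup.mk' H) : Set G)) := by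
      refine step_a ih hG ?_ (P.comapOfKerIsPGroup _ hker hPr) ?_
      · rw [Ne, normalizer_eq_top_iff]
        intro hn
        apply hC0
        have := hmax _ hn hCp
        rw [← map_comap_eq_self_of_surjective hsurj C, eq_bot_iff]
        refine (map_mono this).trans ?_
        rw [QuotientGroup.map_mk'_self]
      · rw [← comap_normalizer_eq_of_surjective C hsurj]
        exact comap_mono (le_normalizer.trans (hC.normalizer_le hCP))
    rw [← comap_normalizer_eq_of_surjective C hsurj] at h2
    have h3 := h2.map (QuotientGroup.mk' H)
    rwa [map_comap_eq_self_of_surjective hsurj] at h3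

/-- central extension step -/
lemma claim0 {H : Subgroup G} [hH : H.Normal] (hHp : IsPGroup p H)
    (hQ : PN p (⊤ : Subgroup (G ⧸ H))) (hc : ∀ x : G, PE p x → ∀ h ∈ H, x * h = h * x) :
    PN p (⊤ : Subgroup G) := by
  let K : Subgroup G := centralizer (H : Set G) ⊓ hQ.core.comap (QuotientGroup.mk' H)
  have hK : ∀ x : G, PE p x → x ∈ K := by
    intro x hx
    refine ⟨mem_centralizer_iff.2 fun h hh => (hc x hx h hh).symm, ?_⟩
    exact ⟨trivial, hx.map _⟩
  let N : Subgroup K := H.subgroupOf K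
  have hNp : IsPGroup p N := hHp.comap_of_injective K.subtype K.subtype_injective
  have hidx : N.index.Coprime p := by
    have h1 : ∀ x : K ⧸ N, PE p x := by
      intro x
      obtain ⟨x, rfl⟩ := QuotientGroup.mk'_surjective _ x
      have h2 : PE p (QuotientGroup.mk' H (x : G)) := x.2.2.2
      rw [PE] at h2 ⊢
      refine Nat.Coprime.coprime_dvd_left ?_ h2
      apply orderOf_dvd_of_pow_eq_one
      rw [← _root_.map_pow]
      refine (QuotientGroup.eq_one_iff _).2 ?_
      rw [mem_subgroupOf]
      have h3 := pow_orderOf_eq_one (QuotientGroup.mk' H (x : G))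
      rw [← _root_.map_pow] at h3
      exact (QuotientGroup.eq_one_iff _).1 h3
    have h2 := coprime_card_of_PE (H := (⊤ : Subgroup (K ⧸ N))) (p := p) (fun x _ => h1 x)
    rwa [card_top] at h2
  obtain ⟨k, hk⟩ := IsPGroup.iff_card.1 hNp
  obtain ⟨L, hL⟩ := exists_right_complement'_of_coprime (N := N) (by
    rw [hk]; exact (Nat.Coprime.pow_right k hidx).symm)
  have hLc : (Nat.card L).Coprime p := by rw [← hL.symm.index_eq_card]; exact hidx
  have key : ∀ x : K, PE p x → x ∈ L := by
    intro x hx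
    obtain ⟨⟨n, l⟩, hnl⟩ := hL.2 x
    simp only at hnl
    have hcomm : Commute (n : K) (l : K) := by
      refine Subtype.ext ?_
      exact mem_centralizer_iff.1 (l : K).2.1 (n : K) n.2
    have h1 : (n : K) ^ orderOf x = ((l : K) ^ orderOf x)⁻¹ := by
      rw [eq_inv_iff_mul_eq_one, ← hcomm.mul_pow, hnl, pow_orderOf_eq_one]
    have h2 : (n : K) ^ orderOf x = 1 := by
      have h3 : (n : K) ^ orderOf x ∈ N ⊓ L :=
        ⟨pow_mem n.2 _, h1 ▸ L.inv_mem (pow_mem l.2 _)⟩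
      rwa [hL.disjoint.eq_bot, mem_bot] at h3
    have h3 : PE p (n : K) := Nat.Coprime.coprime_dvd_left (orderOf_dvd_of_pow_eq_one h2) hx
    have h4 := h3.eq_one hNp n.2
    rw [h4, one_mul] at hnl
    rw [← hnl]
    exact l.2
  intro x _ y _ hx hy
  have h1 := L.mul_mem (key ⟨x, hK x hx⟩ (PE.sub hx)) (key ⟨y, hK y hy⟩ (PE.sub hy))
  exact (PE.of_card hLc h1).coe

end steps

end Th
namespace Th

open Subgroup

section om

variable {p : ℕ} {G : Type*} [Group G]

/-- elements of order dividing `p` in the center of `K` -/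
def Om (p : ℕ) (K : Subgroup G) : Subgroup G where
  carrier := {x | x ∈ K ∧ (∀ y ∈ K, x * y = y * x) ∧ x ^ p = 1}
  one_mem' := ⟨K.one_mem, by simp, by simp⟩
  mul_mem' := fun {a b} ha hb => by
    refine ⟨K.mul_mem ha.1 hb.1, fun y hy => ?_, ?_⟩
    · exact ((show Commute a y from ha.2.1 y hy).mul_left (show Commute b y from hb.2.1 y hy)).eq
    · rw [(show Commute a b from ha.2.1 b hb.1).mul_pow, ha.2.2, hb.2.2, one_mul]
  inv_mem' := fun {a} ha => by
    refine ⟨K.inv_mem ha.1, fun y hy => ?_, ?_⟩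
    · exact (show Commute a y from ha.2.1 y hy).inv_left.eq
    · rw [inv_pow, ha.2.2, inv_one]

lemma mem_Om {K : Subgroup G} {x : G} : x ∈ Om p K ↔ x ∈ K ∧ (∀ y ∈ K, x * y = y * x) ∧ x ^ p = 1 :=
  Iff.rfl

lemma Om_le (K : Subgroup G) : Om p K ≤ K := fun _ hx => hx.1

lemma Om_char (K : Subgroup G) : CharIn (Om p K) K := by
  intro f x hx
  refine ⟨(f x).2, fun y hy => ?_, ?_⟩
  · have h1 := hx.2.1 (f.symm ⟨y, hy⟩) (f.symm ⟨y, hy⟩).2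
    have h2 : x * f.symm ⟨y, hy⟩ = f.symm ⟨y, hy⟩ * x := Subtype.ext h1
    have h3 := congrArg f h2
    rw [_root_.map_mul, _root_.map_mul, MulEquiv.apply_symm_apply] at h3
    exact congrArg Subtype.val h3
  · have h2 : x ^ p = 1 := Subtype.ext hx.2.2
    have h3 := congrArg f h2
    rw [_root_.map_pow, _root_.map_one] at h3
    exact congrArg Subtype.val h3

lemma Om_ne_bot [hp : Fact p.Prime] [Finite G] {K : Subgroup G} (hK : IsPGroup p K) (hK0 : K ≠ ⊥) :
    Om p K ≠ ⊥ := by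
  have : Nontrivial K := (nontrivial_iff_ne_bot K).2 hK0
  have h1 : Nontrivial (center K) := hK.center_nontrivial
  have h2 : IsPGroup p (center K) := hK.to_subgroup _
  obtain ⟨n, hn, hn'⟩ := h2.nontrivial_iff_card.1 h1
  obtain ⟨x, hx⟩ := exists_prime_orderOf_dvd_card' (G := center K) p (by
    rw [hn']; exact dvd_pow_self p hn.ne')
  intro hbot
  have h3 : ((x : K) : G) ∈ Om p K := by
    refine ⟨(x : K).2, fun y hy => ?_, ?_⟩
    · exact congrArg Subtype.val (mem_center_iff.1 x.2 ⟨y, hy⟩).symm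
    · have := pow_orderOf_eq_one x
      rw [hx] at this
      exact congrArg (fun z : center K => ((z : K) : G)) this
  rw [hbot, mem_bot] at h3
  have h4 : x = 1 := Subtype.ext (Subtype.ext h3)
  rw [h4, orderOf_one] at hx
  exact hp.1.ne_one hx.symm

lemma Om_normal {K : Subgroup G} [hK : K.Normal] : (Om p K).Normal := by
  rw [← normalizer_eq_top_iff, eq_top_iff, ← normalizer_eq_top_iff.2 hK]
  exact (Om_char K).normalizer_le (Om_le K)

/-- elementary abelian subgroup of `P` -/
def EA (p : ℕ) (P A : Subgroup G) : Prop :=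
  A ≤ P ∧ (∀ a ∈ A, ∀ b ∈ A, a * b = b * a) ∧ ∀ a ∈ A, a ^ p = 1

/-- elementary abelian subgroup of `P` of maximal order -/
def EAm (p : ℕ) (P A : Subgroup G) : Prop :=
  EA p P A ∧ ∀ A' : Subgroup G, EA p P A' → Nat.card A' ≤ Nat.card A

/-- the Thompson subgroup -/
def J (p : ℕ) (P : Subgroup G) : Subgroup G := sSup {A | EAm p P A}

lemma J_le (P : Subgroup G) : J p P ≤ P := sSup_le fun _ hA => hA.1.1

lemma exists_EAm [Finite G] (P : Subgroup G) : ∃ A, EAm p P A := by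
  obtain ⟨A, hA, hmax⟩ := Set.exists_max_image {A : Subgroup G | EA p P A}
    (fun A => Nat.card A) (Set.toFinite _) ⟨⊥, bot_le, by
      intro a ha b hb
      rw [mem_bot] at ha hb
      simp [ha, hb], by
      intro a ha
      rw [mem_bot] at ha
      simp [ha]⟩
  exact ⟨A, hA, hmax⟩

lemma J_ne_bot [hp : Fact p.Prime] [Finite G] {P : Subgroup G} (hP : IsPGroup p P) (hP0 : P ≠ ⊥) :
    J p P ≠ ⊥ := by
  intro h
  obtain ⟨A, hA⟩ := exists_EAm (p := p) P
  have h1 : A ≤ ⊥ := h ▸ le_sSup (show A ∈ {A | EAm p P A} from hA)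
  have h2 := hA.2 (Om p P) ⟨Om_le P, fun a ha b hb => ha.2.1 b hb.1, fun a ha => ha.2.2⟩
  rw [le_bot_iff.1 h1, card_bot] at h2
  exact Om_ne_bot hP hP0 ((card_le_one_iff_eq_bot _).1 h2)

lemma J_char (P : Subgroup G) : CharIn (J p P) P := by
  intro f x hx
  let ψ : P →* G := P.subtype.comp f.toMonoidHom
  have hψ : Function.Injective ψ := P.subtype_injective.comp f.injective
  have key : J p P ≤ ((J p P).comap ψ).map P.subtype := by
    refine sSup_le fun A hA => ?_
    have hEA : EAm p P ((A.subgroupOf P).map ψ) := by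
      have hcard : Nat.card ((A.subgroupOf P).map ψ) = Nat.card A := by
        rw [card_map_of_injective hψ]
        exact Nat.card_congr (subgroupOfEquivOfLe hA.1.1).toEquiv
      refine ⟨⟨?_, ?_, ?_⟩, ?_⟩
      · rintro _ ⟨a, ha, rfl⟩
        exact (f a).2
      · rintro _ ⟨a, ha, rfl⟩ _ ⟨b, hb, rfl⟩
        rw [← _root_.map_mul, ← _root_.map_mul]
        congr 1
        exact Subtype.ext (hA.1.2.1 a ha b hb)
      · rintro _ ⟨a, ha, rfl⟩
        rw [← _root_.map_pow, (Subtype.ext (hA.1.2.2 a ha) : a ^ p = 1), _root_.map_one]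
      · rw [hcard]; exact hA.2
    intro a ha
    refine ⟨⟨a, hA.1.1 ha⟩, ?_, rfl⟩
    exact le_sSup (show _ ∈ {A | EAm p P A} from hEA) ⟨⟨a, hA.1.1 ha⟩, ha, rfl⟩
  obtain ⟨y, hy, hyx⟩ := key hx
  obtain rfl : y = x := Subtype.ext hyx
  exact hy

lemma J_eq [Finite G] {P H : Subgroup G} (hHP : H ≤ P) (h : ∀ A, EAm p P A → A ≤ H) : J p P = J p H := by
  have hEA : ∀ A, EA p H A → EA p P A := fun A hA => ⟨hA.1.trans hHP, hA.2⟩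
  obtain ⟨A0, hA0⟩ := exists_EAm (p := p) P
  have hA0H : EA p H A0 := ⟨h A0 hA0, hA0.1.2⟩
  have : {A | EAm p P A} = {A | EAm p H A} := by
    ext A
    constructor
    · intro hA
      exact ⟨⟨h A hA, hA.1.2⟩, fun A' hA' => hA.2 A' (hEA _ hA')⟩
    · intro hA
      exact ⟨hEA _ hA.1, fun A' hA' => (hA0.2 A' hA').trans (hA.2 A0 hA0H)⟩
  rw [J, this, J]

end om

section steps2

universe u

variable {p : ℕ} [hp : Fact p.Prime] {G : Type u} [Group G] [Finite G]

lemma exists_T {C : Subgroup G} [hC : C.Normal] {x : G} (hx : PE p x) (hxC : x ∉ C) :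
    ∃ q : ℕ, q.Prime ∧ q ≠ p ∧ ∃ T : Sylow q G, ¬ (T : Subgroup G) ≤ C := by
  by_contra hcon
  push Not at hcon
  have h1 : C.index = p ^ C.index.primeFactorsList.length := by
    apply Nat.eq_prime_pow_of_unique_prime_dvd index_ne_zero_of_finite
    intro q hq hqd
    by_contra hqp
    have : Fact q.Prime := ⟨hq⟩
    obtain ⟨T⟩ : Nonempty (Sylow q G) := inferInstance
    exact not_dvd_index_of_sylow_le T (hcon q hq hqp T) hqd
  have h2 := C.pow_index_mem x
  rw [h1] at h2
  obtain ⟨k, hk⟩ := exists_pow_eq_self_of_coprime (n := p ^ C.index.primeFactorsList.length) (x := x)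
    (Nat.Coprime.pow_right _ hx).symm
  exact hxC (hk ▸ pow_mem h2 k)

lemma lemma_Q (hG : PN p (⊤ : Subgroup G)) {q : ℕ} (hq : q.Prime) (hqp : q ≠ p) (T : Sylow q G) :
    ∃ P : Sylow p G, (P : Subgroup G) ≤ normalizer (T : Set G) := by
  have : Fact q.Prime := ⟨hq⟩
  apply exists_sylow_le
  have hn := hG.core_normal
  have hT : (T : Subgroup G) ≤ hG.core := fun x hx => ⟨trivial, PE.of_qgroup hqp T.2 hx⟩
  have h1 := Sylow.normalizer_sup_eq_top' T hT
  have h2 : (Nat.card hG.core).Coprime p := coprime_card_of_PE fun x hx => hx.2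
  intro hd
  set M := normalizer (T : Set G) with hM
  have h3 : Nat.card (M ⊔ hG.core : Subgroup G) ∣ Nat.card M * Nat.card hG.core := by
    rw [← card_mul_index (hG.core.subgroupOf (M ⊔ hG.core))]
    rw [Nat.card_congr (subgroupOfEquivOfLe (le_sup_right (a := M) (b := hG.core))).toEquiv, mul_comm]
    refine mul_dvd_mul_right ?_ _
    have := relIndex_sup_right M hG.core
    rw [relIndex] at this
    rw [this, relIndex]
    exact index_dvd_card _
  rw [h1, card_top, ← M.card_mul_index] at h3
  have h4 := Nat.dvd_of_mul_dvd_mul_left Nat.card_pos h3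
  have h5 := Nat.dvd_gcd (hd.trans h4) dvd_rfl
  rw [h2] at h5
  exact hp.1.one_lt.ne' (Nat.dvd_one.1 h5)

lemma card_mul_relIdx {H K : Subgroup G} (h : H ≤ K) : Nat.card H * H.relIndex K = Nat.card K := by
  rw [relIndex, ← card_mul_index (H.subgroupOf K), Nat.card_congr (subgroupOfEquivOfLe h).toEquiv]

/-- the intersection of a Sylow subgroup with a normal subgroup is Sylow -/
lemma sylow_inf (P : Sylow p G) (D : Subgroup G) [hD : D.Normal] :
    ¬ p ∣ ((P : Subgroup G).subgroupOf D).index := by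
  intro hd
  have h1 : Nat.card D * D.relIndex P = Nat.card (P ⊔ D : Subgroup G) := by
    rw [← relIndex_sup_right]
    exact card_mul_relIdx le_sup_right
  have h2 : Nat.card ((P : Subgroup G) ⊓ D : Subgroup G) * D.relIndex P = Nat.card (P : Subgroup G) := by
    rw [← inf_relIndex_left]
    exact card_mul_relIdx inf_le_left
  have h3 : Nat.card ((P : Subgroup G) ⊓ D : Subgroup G) * ((P : Subgroup G).subgroupOf D).index = Nat.card D := by
    have := card_mul_relIdx (H := (P : Subgroup G) ⊓ D) (K := D) inf_le_right
    rwa [inf_relIndex_right] at this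
  have h4 : Nat.card (P : Subgroup G) * (P : Subgroup G).relIndex (P ⊔ D) = Nat.card (P ⊔ D : Subgroup G) :=
    card_mul_relIdx le_sup_left
  have h5 : (P : Subgroup G).relIndex (P ⊔ D) = ((P : Subgroup G).subgroupOf D).index := by
    have : Nat.card (P : Subgroup G) * (P : Subgroup G).relIndex (P ⊔ D) =
        Nat.card (P : Subgroup G) * ((P : Subgroup G).subgroupOf D).index := by
      rw [h4, ← h1, ← h2, ← h3]; ring
    exact Nat.eq_of_mul_eq_mul_left Nat.card_pos this
  refine P.not_dvd_index ?_
  rw [← relIndex_mul_index (le_sup_left (a := (P : Subgroup G)) (b := D)), h5]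
  exact hd.mul_right _

lemma lemma_X (ih : IHyp p G) (hG : Hyp p G) {H : Subgroup G} [hH : H.Normal] (hHp : IsPGroup p H)
    (hmax : ∀ K : Subgroup G, K.Normal → IsPGroup p K → K ≤ H)
    {x : G} (hx : PE p x) (hxH : x ∉ centralizer (H : Set G))
    (D : Subgroup G) [hD : D.Normal] (hDH : ∀ y ∈ D, PE p y → y ∈ centralizer (H : Set G))
    (P : Sylow p G) : (P : Subgroup G) ⊓ D ≤ H := by
  by_contra hcon
  have hpp : IsPGroup p ((P : Subgroup G) ⊓ D : Subgroup G) := P.2.to_le inf_le_left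
  set M := normalizer (((P : Subgroup G) ⊓ D : Subgroup G) : Set G) with hM
  have hPM : (P : Subgroup G) ≤ M := by
    intro g hg
    rw [hM, mem_normalizer_iff]
    intro h
    constructor
    · rintro ⟨h1, h2⟩
      exact ⟨P.1.mul_mem (P.1.mul_mem hg h1) (P.1.inv_mem hg), hD.conj_mem _ h2 g⟩
    · rintro ⟨h1, h2⟩
      have e : h = g⁻¹ * (g * h * g⁻¹) * g⁻¹⁻¹ := by group
      rw [e]
      exact ⟨P.1.mul_mem (P.1.mul_mem (P.1.inv_mem hg) h1) (P.1.inv_mem (P.1.inv_mem hg)), hD.conj_mem _ h2 g⁻¹⟩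
  have hMt : M ≠ ⊤ := by
    rw [hM, Ne, normalizer_eq_top_iff]
    intro hn
    exact hcon (hmax _ hn hpp)
  have hPN := step_a ih hG hMt P hPM
  have hMH : ∀ y ∈ M, PE p y → y ∈ centralizer (H : Set G) := by
    intro y hy hyp
    refine mem_centralizer_iff.2 fun h hh => ?_
    refine (PN.centralize (H := H) (M := M) ?_ hHp ?_ hPN hy hyp hh).symm
    · rw [normalizer_eq_top_iff.2 hH]; exact le_top
    · exact (IsPGroup.le_sylow_of_normal hHp P).trans hPM
  have hfr : M ⊔ D = ⊤ := by
    have := Sylow.normalizer_sup_eq_top (N := D)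
      ((P.2.comap_of_injective D.subtype D.subtype_injective).toSylow (sylow_inf P D))
    have e : (((P.2.comap_of_injective D.subtype D.subtype_injective).toSylow (sylow_inf P D) : Sylow p D) : Subgroup D).map D.subtype = (P : Subgroup G) ⊓ D :=
      subgroupOf_map_subtype _ _
    rwa [e] at this
  let f := QuotientGroup.mk' (centralizer (H : Set G))
  have hf : ∀ y, f y = 1 ↔ y ∈ centralizer (H : Set G) := fun y => QuotientGroup.eq_one_iff y
  have h1 : IsPGroup p (M.map f) := isPGroup_map_of_PE f fun y hy hyp => (hf y).2 (hMH y hy hyp)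
  have h2 : IsPGroup p (D.map f) := isPGroup_map_of_PE f fun y hy hyp => (hf y).2 (hDH y hy hyp)
  have h3 : (D.map f).Normal := hD.map f (QuotientGroup.mk'_surjective _)
  have h4 := h1.to_sup_of_normal_right h2
  rw [← Subgroup.map_sup, hfr] at h4
  exact hxH ((hf x).1 ((hx.map f).eq_one h4 ⟨x, trivial, rfl⟩))

end steps2

end Th
namespace Th

open Subgroup

section steps3

universe u

variable {p : ℕ} [hp : Fact p.Prime] {G : Type u} [Group G] [Finite G]

lemma comm_char {K : Type*} [Group K] (T : Subgroup K) : CharIn ⁅T, T⁆ T := by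
  intro f x hx
  rw [← map_subtype_commutator] at hx ⊢
  obtain ⟨y, hy, hyx⟩ := hx
  obtain rfl : y = x := Subtype.ext hyx
  refine ⟨f y, ?_, rfl⟩
  have h1 : (_root_.commutator T).comap f.toMonoidHom = _root_.commutator T :=
    Characteristic.fixed inferInstance f
  have h2 : y ∈ (_root_.commutator T).comap f.toMonoidHom := by rw [h1]; exact hy
  exact h2

lemma step_PT (ih : IHyp p G) (hG : Hyp p G) {H : Subgroup G} [hH : H.Normal] (hHp : IsPGroup p H)
    (hQ : PN p (⊤ : Subgroup (G ⧸ H)))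
    {x : G} (hx : PE p x) (hxH : x ∉ centralizer (H : Set G)) :
    ∃ (P : Sylow p G) (T : Subgroup G), (∀ t ∈ T, PE p t) ∧
      (∀ x ∈ (P : Subgroup G), ∀ t ∈ T, ∃ t' ∈ T, ∃ h ∈ H, x * t * x⁻¹ = t' * h) ∧
      (P : Subgroup G) ⊔ T = ⊤ ∧ ∀ a ∈ T, ∀ b ∈ T, a * b * a⁻¹ * b⁻¹ ∈ centralizer (H : Set G) := by
  obtain ⟨q, hq, hqp, T, hT⟩ := exists_T hx hxH
  have : Fact q.Prime := ⟨hq⟩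
  let π := QuotientGroup.mk' H
  have hsurj : Function.Surjective π := QuotientGroup.mk'_surjective H
  have hker : IsPGroup p π.ker := by rwa [QuotientGroup.ker_mk']
  have hπ : ∀ y, π y = 1 ↔ y ∈ H := fun y => QuotientGroup.eq_one_iff y
  have hTp : ∀ t ∈ (T : Subgroup G), PE p t := fun t ht => PE.of_qgroup hqp T.2 ht
  let T' : Subgroup (G ⧸ H) := (T : Subgroup G).map π
  have hT'q : IsPGroup q T' := T.2.map π
  have hT'p : ∀ t ∈ T', PE p t := fun t ht => PE.of_qgroup hqp hT'q ht
  obtain ⟨P', hP'⟩ := lemma_Q hQ hq hqp (T.mapSurjective hsurj)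
  replace hP' : (P' : Subgroup (G ⧸ H)) ≤ normalizer (T' : Set (G ⧸ H)) := hP'
  have hPr : (P' : Subgroup (G ⧸ H)) ≤ π.range := by
    rw [MonoidHom.range_eq_top.2 hsurj]; exact le_top
  let P : Sylow p G := P'.comapOfKerIsPGroup π hker hPr
  have hPdef : (P : Subgroup G) = (P' : Subgroup (G ⧸ H)).comap π := rfl
  have hHP : H ≤ P := IsPGroup.le_sylow_of_normal hHp P
  have hcen : ∀ M : Subgroup G, M ≠ ⊤ → (P : Subgroup G) ≤ M → ∀ y ∈ M, PE p y →
      y ∈ centralizer (H : Set G) := by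
    intro M hM hPM y hy hyp
    refine mem_centralizer_iff.2 fun h hh => ?_
    refine (PN.centralize (H := H) (M := M) ?_ hHp (hHP.trans hPM) (step_a ih hG hM P hPM) hy hyp hh).symm
    rw [normalizer_eq_top_iff.2 hH]; exact le_top
  refine ⟨P, T, hTp, ?_, ?_, ?_⟩
  · intro x hx t ht
    have h1 : π x * π t * (π x)⁻¹ ∈ T' := (mem_normalizer_iff.1 (hP' hx) _).1 ⟨t, ht, rfl⟩
    obtain ⟨t', ht', e⟩ := h1
    refine ⟨t', ht', t'⁻¹ * (x * t * x⁻¹), ?_, by group⟩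
    rw [← hπ]
    simp only [_root_.map_mul, _root_.map_inv]
    rw [e]
    group
  · by_contra hne
    exact hT fun t ht => hcen _ hne le_sup_left t (le_sup_right (a := (P : Subgroup G)) ht) (hTp t ht)
  · let D' : Subgroup (G ⧸ H) := ⁅T', T'⁆
    have hD'T : D' ≤ T' := by
      show ⁅T', T'⁆ ≤ T'
      rw [← map_subtype_commutator T']
      exact map_subtype_le _
    have hPD : (P' : Subgroup (G ⧸ H)) ≤ normalizer (D' : Set (G ⧸ H)) :=
      hP'.trans ((comm_char T').normalizer_le hD'T)
    have hne : (P : Subgroup G) ⊔ D'.comap π ≠ ⊤ := by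
      intro htop
      have h1 := congrArg (Subgroup.map π) htop
      rw [Subgroup.map_sup, hPdef, map_comap_eq_self_of_surjective hsurj,
        map_comap_eq_self_of_surjective hsurj, map_top_of_surjective _ hsurj] at h1
      have h2 := coe_mul_of_left_le_normalizer_right _ _ hPD
      rw [h1] at h2
      have h3 : T' ≤ D' := by
        intro t ht
        have : t ∈ ((⊤ : Subgroup (G ⧸ H)) : Set (G ⧸ H)) := trivial
        rw [h2] at this
        obtain ⟨u, hu, d, hd, e⟩ := this
        simp only at e
        have hu' : u ∈ T' := by
          have : u = t * d⁻¹ := by rw [← e]; group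
          rw [this]
          exact mul_mem ht (inv_mem (hD'T hd))
        have := (hT'p u hu').eq_one P'.2 hu
        rw [this, one_mul] at e
        rw [← e]
        exact hd
      have h4 : T' = ⊥ := by
        by_contra hbot
        have : Nontrivial T' := (nontrivial_iff_ne_bot T').2 hbot
        have hnil : Group.IsNilpotent T' := hT'q.isNilpotent
        have hsol : Group.IsSolvable T' := inferInstance
        have h5 := Group.IsSolvable.commutator_lt_top_of_nontrivial T'
        apply h5.ne
        rw [eq_top_iff]
        intro t _
        have h6 := h3 t.2
        change (t : G ⧸ H) ∈ ⁅T', T'⁆ at h6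
        rw [← map_subtype_commutator] at h6
        obtain ⟨y, hy, hyt⟩ := h6
        obtain rfl : y = t := Subtype.ext hyt
        exact hy
      apply hT
      intro t ht
      have h5 : π t ∈ T' := ⟨t, ht, rfl⟩
      rw [h4, mem_bot, hπ] at h5
      rw [(hTp t ht).eq_one hHp h5]
      exact one_mem _
    intro a ha b hb
    have hab : a * b * a⁻¹ * b⁻¹ ∈ (T : Subgroup G) :=
       T.1.mul_mem (T.1.mul_mem (T.1.mul_mem ha hb) (T.1.inv_mem ha)) (T.1.inv_mem hb)
    refine hcen _ hne le_sup_left _ (mem_sup_right ?_) (hTp _ hab)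
    rw [mem_comap]
    simp only [_root_.map_mul, _root_.map_inv]
    exact commutator_mem_commutator ⟨a, ha, rfl⟩ ⟨b, hb, rfl⟩

end steps3

section rep

/-- automorphisms of an abelian group as additive endomorphisms -/
def rep (V : Type*) [CommGroup V] : MulAut V →* AddMonoid.End (Additive V) where
  toFun f := MonoidHom.toAdditive f.toMonoidHom
  map_one' := rfl
  map_mul' _ _ := rfl

lemma rep_apply (V : Type*) [CommGroup V] (f : MulAut V) (v : V) :
    rep V f (Additive.ofMul v) = Additive.ofMul (f v) := rfl

lemma rep_inj (V : Type*) [CommGroup V] : Function.Injective (rep V) := by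
  intro f g h
  refine MulEquiv.ext fun v => ?_
  have := congrArg (fun e : AddMonoid.End (Additive V) => e (Additive.ofMul v)) h
  exact this

end rep

end Th
namespace Th

open Subgroup

section count

variable {p : ℕ} [hp : Fact p.Prime] {G : Type*} [Group G] [Finite G]

lemma count (hodd : Odd p) {V : Type*} [CommGroup V] [Finite V] (φ : G →* MulAut V) (ι : V →* G)
    (hι : Function.Injective ι) (hφ : ∀ g v, ι (φ g v) = g * ι v * g⁻¹) (hVp : ∀ v : V, v ^ p = 1)
    (P : Subgroup G) (hιP : ∀ v, ι v ∈ P) (T : Subgroup G) (hTp : ∀ t ∈ T, PE p t)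
    (hTc : ∀ a ∈ T, ∀ b ∈ T, φ a * φ b = φ b * φ a)
    (hPT : P.map φ ≤ normalizer (T.map φ : Set (MulAut V)))
    (hPf : ∀ x ∈ P, (∀ t ∈ T, φ x * φ t = φ t * φ x) → φ x = 1)
    (A : Subgroup G) (hA : EAm p P A) : ∀ a ∈ A, φ a = 1 := by
  by_contra hcon
  push Not at hcon
  obtain ⟨a₀, ha₀, ha₀1⟩ := hcon
  have : Finite (Additive V) := ‹Finite V›
  have hlt := core_lemma (p := p) (rep V) hodd (fun v => by
      have := hVp v.toMul
      exact this) (rep_inj V) (T.map φ)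
    (by rintro _ ⟨a, ha, rfl⟩ _ ⟨b, hb, rfl⟩; exact hTc a ha b hb)
    (by rintro _ ⟨a, ha, rfl⟩; exact (hTp a ha).map φ) _ (A.map φ) rfl
    (by rintro _ ⟨a, ha, rfl⟩ _ ⟨b, hb, rfl⟩
        rw [← _root_.map_mul, hA.1.2.1 a ha b hb, _root_.map_mul])
    (by rintro _ ⟨a, ha, rfl⟩
        rw [← _root_.map_pow, hA.1.2.2 a ha, _root_.map_one])
    ((map_mono hA.1.1).trans hPT)
    (by rintro _ ⟨a, ha, rfl⟩ h
        exact hPf a (hA.1.1 ha) fun t ht => h _ ⟨t, ht, rfl⟩)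
    (by intro h
        have : φ a₀ ∈ A.map φ := ⟨a₀, ha₀, rfl⟩
        rw [h, mem_bot] at this
        exact ha₀1 this)
  let ψ : A →* MulAut V := φ.comp A.subtype
  have hψ : ψ.range = A.map φ := by
    rw [MonoidHom.range_comp, range_subtype]
  have hcA : Nat.card ψ.ker * Nat.card (A.map φ) = Nat.card A := by
    rw [← hψ, ← index_ker, card_mul_index]
  let κ : ψ.ker →* G := A.subtype.comp ψ.ker.subtype
  have hcomm : ∀ v k, Commute (ι v) (κ k) := by
    intro v k
    have h1 := hφ (κ k) v
    have h2 : φ (κ k) = 1 := k.2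
    rw [h2] at h1
    have h3 : ι v * κ k = κ k * ι v := by
      rw [show ((1 : MulAut V) v) = v from rfl] at h1
      nth_rewrite 1 [h1]
      group
    exact h3
  let f : V × ψ.ker →* G := MonoidHom.noncommCoprod ι κ hcomm
  have hf : ∀ v k, f (v, k) = ι v * κ k := fun v k => rfl
  have hcf : Nat.card f.ker * Nat.card f.range = Nat.card V * Nat.card ψ.ker := by
    rw [← index_ker, card_mul_index, Nat.card_prod]
  have hκA : ∀ k, κ k ∈ A := fun k => k.1.2
  have hEA : EA p P f.range := by
    refine ⟨?_, ?_, ?_⟩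
    · rintro _ ⟨⟨v, k⟩, rfl⟩
      rw [hf]
      exact mul_mem (hιP v) (hA.1.1 (hκA k))
    · rintro _ ⟨⟨v, k⟩, rfl⟩ _ ⟨⟨v', k'⟩, rfl⟩
      rw [← _root_.map_mul, ← _root_.map_mul, Prod.mk_mul_mk, Prod.mk_mul_mk, mul_comm v v']
      congr 2
      exact Subtype.ext (Subtype.ext (hA.1.2.1 _ (hκA k) _ (hκA k')))
    · rintro _ ⟨⟨v, k⟩, rfl⟩
      rw [hf, (hcomm v k).mul_pow, ← _root_.map_pow, hVp, _root_.map_one, one_mul]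
      exact hA.1.2.2 _ (hκA k)
  have h1 := hA.2 _ hEA
  have h2 : Nat.card f.ker ≤ Nat.card (fx (rep V) (A.map φ)) := by
    have hz : ∀ z : f.ker, ι z.1.1 = (κ z.1.2)⁻¹ := by
      rintro ⟨⟨v, k⟩, hz⟩
      exact eq_inv_of_mul_eq_one_left hz
    refine Nat.card_le_card_of_injective
      (fun z : f.ker => (⟨Additive.ofMul z.1.1, ?_⟩ : fx (rep V) (A.map φ))) ?_
    · rw [mem_fx]
      rintro _ ⟨a, ha, rfl⟩
      rw [rep_apply]
      congr 1
      apply hι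
      rw [hφ, hz]
      rw [hA.1.2.1 a ha _ (inv_mem (hκA _))]
      group
    · intro z z' h
      have h3 : z.1.1 = z'.1.1 := 
        congrArg (fun y : fx (rep V) (A.map φ) => Additive.toMul y.1) h
      have h4 : κ z.1.2 = κ z'.1.2 := by
        have := hz z
        rw [h3, hz z'] at this
        exact (inv_injective this).symm
      exact Subtype.ext (Prod.ext h3 (Subtype.ext (Subtype.ext h4)))
  have hV : Nat.card (Additive V) = Nat.card V := rfl
  rw [hV] at hlt
  have hpos : 0 < Nat.card ψ.ker := Nat.card_pos
  have h5 : Nat.card V * Nat.card ψ.ker ≤ Nat.card (fx (rep V) (A.map φ)) * Nat.card A := by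
    rw [← hcf]; exact Nat.mul_le_mul h2 h1
  rw [← hcA] at h5
  have h6 := Nat.mul_lt_mul_of_pos_right hlt hpos
  have h7 : Nat.card (fx (rep V) (A.map φ)) * (Nat.card ψ.ker * Nat.card (A.map φ)) =
    Nat.card (A.map φ) * Nat.card (fx (rep V) (A.map φ)) * Nat.card ψ.ker := by ring
  omega

end count

section main

lemma le_normalizer_of {K : Type*} [Group K] {S E : Subgroup K}
    (h : ∀ u ∈ S, ∀ e ∈ E, u * e * u⁻¹ ∈ E) : S ≤ normalizer (E : Set K) := by
  intro u hu
  rw [mem_normalizer_iff]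
  refine fun e => ⟨h u hu e, fun he => ?_⟩
  have := h _ (inv_mem hu) _ he
  convert this using 1
  group

universe u

variable {p : ℕ} [hp : Fact p.Prime] {G : Type u} [Group G] [Finite G]

lemma step_main (hodd : Odd p) (ih : IHyp p G) (hG : Hyp p G) : PN p (⊤ : Subgroup G) := by
  by_contra hn
  obtain ⟨X, hX, hXp, hX0⟩ := step_b ih hG hn
  obtain ⟨H, hH, hHp, hH0, hmax⟩ := step_H X hX hXp hX0
  have hQ := step_quot ih hG hHp hH0 hmax
  obtain ⟨x, hx, hxH⟩ : ∃ x : G, PE p x ∧ x ∉ centralizer (H : Set G) := by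
    by_contra hcon
    push Not at hcon
    exact hn (claim0 hHp hQ fun x hx h hh => (mem_centralizer_iff.1 (hcon x hx) h hh).symm)
  obtain ⟨P, T, hTp, hPT, hPTtop, hTc⟩ := step_PT ih hG hHp hQ hx hxH
  have hHP : H ≤ P := IsPGroup.le_sylow_of_normal hHp P
  have hP0 : (P : Subgroup G) ≠ ⊥ := by
    intro h; rw [h] at hHP; exact hH0 (le_bot_iff.1 hHP)
  have hVn : (Om p H).Normal := Om_normal
  have hHn : normalizer (H : Set G) = ⊤ := normalizer_eq_top_iff.2 hH
  have hCH : (centralizer (H : Set G)).Normal := normal_centralizer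
  have hPC : (P : Subgroup G) ⊓ centralizer (H : Set G) ≤ H :=
    lemma_X ih hG hHp hmax hx hxH _ (fun y hy _ => hy) P
  have hZV : Om p (P : Subgroup G) ≤ Om p H := by
    intro z hz
    have hzH : z ∈ H := hPC ⟨hz.1, mem_centralizer_iff.2 fun h hh => (hz.2.1 h (hHP hh)).symm⟩
    exact ⟨hzH, fun y hy => hz.2.1 y (hHP hy), hz.2.2⟩
  have hNZ : PN p (normalizer (Om p (P : Subgroup G) : Set G)) :=
    hG P _ (Om_le _) (Om_ne_bot P.2 hP0) (Om_char _)
  have hPNZ : (P : Subgroup G) ≤ normalizer (Om p (P : Subgroup G) : Set G) :=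
    le_normalizer.trans ((Om_char (P : Subgroup G)).normalizer_le (Om_le _))
  have hCV : ∀ y ∈ centralizer (Om p H : Set G), PE p y → y ∈ centralizer (H : Set G) := by
    intro y hy hyp
    have hyZ : y ∈ normalizer (Om p (P : Subgroup G) : Set G) :=
      centralizer_le_normalizer _ (centralizer_le hZV hy)
    refine mem_centralizer_iff.2 fun h hh => ?_
    exact (PN.centralize (H := H) (by rw [hHn]; exact le_top) hHp (hHP.trans hPNZ) hNZ hyZ hyp hh).symm
  have hCVn : (centralizer (Om p H : Set G)).Normal := normal_centralizer
  have hPCV : (P : Subgroup G) ⊓ centralizer (Om p H : Set G) ≤ H :=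
    lemma_X ih hG hHp hmax hx hxH _ hCV P
  let _ : CommGroup (Om p H) :=
    { (inferInstance : Group (Om p H)) with
      mul_comm := fun a b => Subtype.ext (a.2.2.1 b b.2.1) }
  let φ : G →* MulAut (Om p H) := MulAut.conjNormal
  have hφ : ∀ g (v : Om p H), ((φ g v : Om p H) : G) = g * v * g⁻¹ := fun g v => rfl
  have hφ1 : ∀ g, φ g = 1 ↔ g ∈ centralizer (Om p H : Set G) := by
    intro g
    rw [mem_centralizer_iff]
    constructor
    · intro h v hv
      have h1 := hφ g ⟨v, hv⟩
      rw [h] at h1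
      have h2 : v = g * v * g⁻¹ := h1
      nth_rewrite 1 [h2]
      group
    · intro h
      refine MulEquiv.ext fun v => Subtype.ext ?_
      rw [hφ, ← h v v.2]
      simp
  have hφc : ∀ g ∈ centralizer (H : Set G), φ g = 1 := fun g hg =>
    (hφ1 g).2 (centralizer_le (Om_le H) hg)
  have hφH : ∀ g ∈ H, φ g = 1 := fun g hg =>
    (hφ1 g).2 (mem_centralizer_iff.2 fun v hv => hv.2.1 g hg)
  have hTc' : ∀ a ∈ T, ∀ b ∈ T, φ a * φ b = φ b * φ a := by
    intro a ha b hb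
    have := hφc _ (hTc a ha b hb)
    simp only [_root_.map_mul, _root_.map_inv] at this
    exact (mul_inv_eq_iff_eq_mul.1 (mul_inv_eq_one.1 this))
  have hPT0 : ∀ x ∈ (P : Subgroup G), ∀ t ∈ T, φ x * φ t * (φ x)⁻¹ ∈ T.map φ := by
    intro x hx t ht
    obtain ⟨t', ht', h, hh, e⟩ := hPT x hx t ht
    refine ⟨t', ht', ?_⟩
    rw [← _root_.map_inv, ← _root_.map_mul, ← _root_.map_mul, e, _root_.map_mul, hφH h hh, mul_one]
  have hPT' : (P : Subgroup G).map φ ≤ normalizer (T.map φ : Set (MulAut (Om p H))) := by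
    rintro _ ⟨x, hx, rfl⟩
    rw [mem_normalizer_iff]
    intro s
    constructor
    · rintro ⟨t, ht, rfl⟩
      exact hPT0 x hx t ht
    · rintro ⟨t, ht, e⟩
      have := hPT0 x⁻¹ (inv_mem hx) t ht
      rw [e] at this
      convert this using 1
      simp only [_root_.map_inv]
      group
  -- elements of `P` centralizing the image of `T` act trivially
  have hPf : ∀ x ∈ (P : Subgroup G), (∀ t ∈ T, φ x * φ t = φ t * φ x) → φ x = 1 := by
    let E : Subgroup (MulAut (Om p H)) := (P : Subgroup G).map φ ⊓ centralizer (T.map φ : Set _)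
    let D : Subgroup G := E.comap φ
    have hEp : IsPGroup p E := (P.2.map φ).to_le inf_le_left
    have hDn : D.Normal := by
      rw [← normalizer_eq_top_iff, eq_top_iff, ← hPTtop]
      have hE : (P : Subgroup G).map φ ≤ normalizer (E : Set (MulAut (Om p H))) := by
        refine le_normalizer_of fun u hu e he =>
          mem_inf.2 ⟨mul_mem (mul_mem hu (mem_inf.1 he).1) (inv_mem hu), ?_⟩
        rw [mem_centralizer_iff]
        intro s hs
        have h1 := mem_centralizer_iff.1 he.2 (u⁻¹ * s * u) (by
          have := (mem_normalizer_iff.1 (hPT' (inv_mem hu)) s).1 hs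
          rwa [inv_inv] at this)
        calc s * (u * e * u⁻¹) = u * (u⁻¹ * s * u * e) * u⁻¹ := by group
          _ = u * (e * (u⁻¹ * s * u)) * u⁻¹ := by rw [h1]
          _ = u * e * u⁻¹ * s := by group
      have hE' : T.map φ ≤ normalizer (E : Set (MulAut (Om p H))) := by
        refine le_normalizer_of fun u hu e he => ?_
        rw [mem_centralizer_iff.1 he.2 u hu, mul_inv_cancel_right]
        exact he
      have hD : ∀ g, φ g ∈ normalizer (E : Set (MulAut (Om p H))) → g ∈ normalizer (D : Set G) := by
        intro g hg
        rw [mem_normalizer_iff] at hg ⊢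
        intro y
        show φ y ∈ E ↔ φ (g * y * g⁻¹) ∈ E
        rw [hg (φ y)]
        simp only [_root_.map_mul, _root_.map_inv]
      exact sup_le (fun g hg => hD g (hE ⟨g, hg, rfl⟩)) (fun g hg => hD g (hE' ⟨g, hg, rfl⟩))
    have hDH : (P : Subgroup G) ⊓ D ≤ H := by
      refine lemma_X ih hG hHp hmax hx hxH D (fun y hy hyp => ?_) P
      exact hCV y ((hφ1 y).1 ((hyp.map φ).eq_one hEp hy)) hyp
    intro y hy hyT
    refine hφH y (hDH ⟨hy, ⟨y, hy, rfl⟩, ?_⟩)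
    rintro _ ⟨t, ht, rfl⟩
    exact (hyT t ht).symm
  have hJ : J p (P : Subgroup G) = J p H := by
    refine J_eq hHP fun A hA => ?_
    have := count hodd φ (Om p H).subtype (Om p H).subtype_injective hφ
      (fun v => Subtype.ext v.2.2.2) P (fun v => hHP v.2.1) T hTp hTc' hPT' hPf A hA
    exact fun a ha => hPCV ⟨hA.1.1 ha, (hφ1 a).1 (this a ha)⟩
  have h1 := hG P _ (J_le _) (J_ne_bot P.2 hP0) (J_char _)
  rw [hJ] at h1
  have h2 : normalizer (J p H : Set G) = ⊤ := by
    rw [eq_top_iff, ← hHn]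
    exact (J_char H).normalizer_le (J_le H)
  rw [h2] at h1
  exact hn h1

theorem thompson (hodd : Odd p) : ∀ n, ∀ (G : Type u) [Group G] [Finite G], Nat.card G = n →
    Hyp p G → PN p (⊤ : Subgroup G) := by
  intro n
  induction n using Nat.strong_induction_on with
  | _ n ih =>
  intro G _ _ hn hG
  refine step_main hodd ?_ hG
  intro K _ _ hK hKH
  exact ih _ (hn ▸ hK) K rfl hKH

end main

end Th
theorem stmt_3 {G : Type*} [Group G] [Finite G] (N : Subgroup G) (hN : N.Normal)
    (hNmin : N ≠ ⊥ ∧ ∀ K : Subgroup G, K.Normal → K ≠ ⊥ → K ≤ N → K = N)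
    (hNns : ¬ IsSolvable N)
    (p : ℕ) (hp : p.Prime) (hpodd : Odd p) (hpdvd : p ∣ Nat.card N)
    (P : Sylow p N) :
    ∃ M : Subgroup G, IsCoatom M ∧
      Subgroup.normalizer (Subgroup.map N.subtype (P : Subgroup N)) ≤ M ∧
      ¬ N ≤ M ∧ ¬ IsPNilpotent p M := by
  have hpf : Fact p.Prime := ⟨hp⟩
  have hNnp : ¬ IsPGroup p N := by
    intro h
    have hnil : Group.IsNilpotent N := h.isNilpotent
    have hsol : Group.IsSolvable N := inferInstance
    exact hNns hsol
  by_contra hcon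
  push Not at hcon
  have hM1 : ∀ M : Subgroup G, M ≠ ⊤ →
      Subgroup.normalizer (Subgroup.map N.subtype (P : Subgroup N) : Set G) ≤ M → Th.PN p M := by
    intro M hM hle
    obtain h | ⟨M', hM', hMM'⟩ := eq_top_or_exists_le_coatom M
    · exact absurd h hM
    · have hNM : ¬ N ≤ M' := by
        intro h
        have h1 := Sylow.normalizer_sup_eq_top P
        apply hM'.1
        rw [eq_top_iff, ← h1]
        exact sup_le (hle.trans hMM') h
      obtain ⟨K, hK, h⟩ := hcon M' hM' (hle.trans hMM') hNM
      exact (Th.PN.of_isPNilpotent K hK h).mono hMM'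
  have hM2 : ∀ S : Sylow p N, ∀ M : Subgroup G, M ≠ ⊤ →
      Subgroup.normalizer (Subgroup.map N.subtype (S : Subgroup N) : Set G) ≤ M → Th.PN p M := by
    intro S M hM hle
    obtain ⟨n, hn⟩ := MulAction.exists_smul_eq N S P
    have hnS : ∀ s : G, s ∈ Subgroup.map N.subtype (S : Subgroup N) ↔
        (n : G) * s * (n : G)⁻¹ ∈ Subgroup.map N.subtype (P : Subgroup N) := by
      intro s
      rw [← hn, Sylow.coe_subgroup_smul]
      constructor
      · rintro ⟨y, hy, rfl⟩
        exact ⟨n * y * n⁻¹, ⟨y, hy, rfl⟩, rfl⟩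
      · rintro ⟨_, ⟨y, hy, rfl⟩, e⟩
        refine ⟨y, hy, ?_⟩
        have e' : (n : G) * y * (n : G)⁻¹ = n * s * (n : G)⁻¹ := e
        exact mul_left_cancel (mul_right_cancel e')
    let c : G →* G := (MulAut.conj (n : G)⁻¹).toMonoidHom
    have hc : ∀ g, c g = (n : G)⁻¹ * g * n := by
      intro g
      show (n : G)⁻¹ * g * ((n : G)⁻¹)⁻¹ = _
      rw [inv_inv]
    have hcs : Function.Surjective c := (MulAut.conj (n : G)⁻¹).surjective
    have h1 : Th.PN p (M.comap c) := by
      apply hM1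
      · intro h
        apply hM
        rw [eq_top_iff]
        intro g _
        obtain ⟨g', rfl⟩ := hcs g
        have : g' ∈ M.comap c := by rw [h]; trivial
        exact this
      · intro g hg
        apply hle
        rw [hc]
        rw [Subgroup.mem_normalizer_iff] at hg ⊢
        intro s
        rw [hnS, hnS, hg]
        have : (n : G) * ((n : G)⁻¹ * g * n * s * ((n : G)⁻¹ * g * n)⁻¹) * (n : G)⁻¹ =
          g * (n * s * (n : G)⁻¹) * g⁻¹ := by group
        rw [this]
    have h2 := h1.map c
    rwa [Subgroup.map_comap_eq_self_of_surjective hcs] at h2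
  have hHyp : Th.Hyp p N := by
    intro S C hCS hC0 hC
    have hC' := hC.map hCS N.subtype N.subtype_injective
    have hne : Subgroup.normalizer (C.map N.subtype : Set G) ≠ ⊤ := by
      intro h
      rw [Subgroup.normalizer_eq_top_iff] at h
      have h1 := hNmin.2 _ h (by
        rwa [Ne, Subgroup.map_eq_bot_iff_of_injective _ N.subtype_injective])
        (Subgroup.map_subtype_le C)
      apply hNnp
      rintro ⟨x, hx⟩
      have hx' := hx
      rw [← h1] at hx'
      obtain ⟨y, hy, e⟩ := hx'
      obtain ⟨k, hk⟩ := S.2 ⟨y, hCS hy⟩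
      refine ⟨k, ?_⟩
      have : y = ⟨x, hx⟩ := Subtype.ext e
      rw [← this]
      simpa using congrArg Subtype.val hk
    have h1 := hM2 S _ hne (hC'.normalizer_le (Subgroup.map_mono hCS))
    refine (Th.PN.comap N.subtype_injective h1).mono ?_
    intro g hg
    rw [Subgroup.mem_comap, Subgroup.mem_normalizer_iff]
    rw [Subgroup.mem_normalizer_iff] at hg
    intro s
    constructor
    · rintro ⟨y, hy, rfl⟩
      exact ⟨g * y * g⁻¹, (hg y).1 hy, rfl⟩
    · rintro ⟨y, hy, e⟩
      have e' : (y : G) = g * s * (g : G)⁻¹ := e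
      have hs : (g : G)⁻¹ * y * g = s := by
        rw [e']
        group
      refine ⟨g⁻¹ * y * g, (hg _).2 ?_, hs⟩
      have e2 : g * (g⁻¹ * y * g) * g⁻¹ = y := by group
      rw [e2]
      exact hy
  have hPN : Th.PN p N := Th.PN.of_top (Th.thompson hpodd _ N rfl hHyp)
  have hcn : hPN.core.Normal := hPN.core_normal
  by_cases hb : hPN.core = ⊥
  · apply hNnp
    apply Th.isPGroup_of_PE
    intro x hx hxp
    have : x ∈ hPN.core := ⟨hx, hxp⟩
    rwa [hb, Subgroup.mem_bot] at this
  · have h1 := hNmin.2 _ hcn hb fun x hx => hx.1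
    have h2 : (Nat.card N).Coprime p := Th.coprime_card_of_PE fun x hx => by
      rw [← h1] at hx
      exact hx.2
    exact (Nat.Prime.coprime_iff_not_dvd hp).1 h2.symm hpdvd
end
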